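/- arXiv:1612.03390 — 3 statements merged into one kernel-verified Lean document; each statement's English description precedes it below -/
import Mathlib

section
/- Let n ∈ ℕ with n ≥ 1 and β ∈ (0,1]. Every Φ ∈ D^{n,β}(ℝ^d) is a Cⁿ-diffeomorphism of ℝ^d, and the derivatives of order 1, …, n of Φ⁻¹ are globally bounded on ℝ^d. -/
open Function Set Filter Topology MeasureTheory
open scoped ENNReal NNReal

noncomputable section

section Defs

variable {E F : Type*} [NormedAddCommGroup E] [NormedSpace ℝ E]
  [NormedAddCommGroup F] [NormedSpace ℝ F]

/-- `‖f‖_n = max_{0 ≤ l ≤ n} sup_x ‖f⁽ˡ⁾(x)‖`, as an extended real. -/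
def eCnb (n : ℕ) (f : E → F) : ℝ≥0∞ :=
  ⨆ (l : Fin (n + 1)) (x : E), (‖iteratedFDeriv ℝ (l : ℕ) f x‖₊ : ℝ≥0∞)

/-- The Hölder seminorm `[f]_{n,α}`, as an extended real. -/
def eHsemi (n : ℕ) (α : ℝ) (f : E → F) : ℝ≥0∞ :=
  ⨆ (x : E) (y : E) (_ : x ≠ y),
    (‖iteratedFDeriv ℝ n f x - iteratedFDeriv ℝ n f y‖₊ : ℝ≥0∞) / edist x y ^ α

/-- The Hölder norm `‖f‖_{n,α} = max(‖f‖_n, [f]_{n,α})`, as an extended real. -/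
def eHnorm (n : ℕ) (α : ℝ) (f : E → F) : ℝ≥0∞ := max (eCnb n f) (eHsemi n α f)

/-- The Hölder norm `‖f‖_{n,α}` as a real number (junk value `0` when infinite). -/
def hnorm (n : ℕ) (α : ℝ) (f : E → F) : ℝ := (eHnorm n α f).toReal

/-- Membership in the global Hölder space `C^{n,α}_b(E,F)`. -/
def MemCb (n : ℕ) (α : ℝ) (f : E → F) : Prop :=
  ContDiff ℝ (n : ℕ∞) f ∧ eHnorm n α f < ⊤

/-- Membership in `C^{n,α}_0(E,F)`: moreover all derivatives up to order `n`
vanish at infinity. -/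
def MemC0 (n : ℕ) (α : ℝ) (f : E → F) : Prop :=
  MemCb n α f ∧
    ∀ l ≤ n, Tendsto (fun x => ‖iteratedFDeriv ℝ l f x‖) (cocompact E) (𝓝 0)

end Defs

/-- `ℝ^d` -/
abbrev Euc (d : ℕ) : Type := EuclideanSpace ℝ (Fin d)

/-- Membership in the diffeomorphism group `D^{n,β}(ℝ^d)`:
`Φ - Id ∈ C^{n,β}_0` and `det dΦ(x) > 0` everywhere. -/
def MemD (d n : ℕ) (β : ℝ) (Φ : Euc d → Euc d) : Prop :=
  MemC0 n β (fun x => Φ x - x) ∧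
    ∀ x, 0 < LinearMap.det ((fderiv ℝ Φ x : Euc d →L[ℝ] Euc d) : Euc d →ₗ[ℝ] Euc d)

end

section ProperMaps

variable {X Y : Type*} [TopologicalSpace X] [TopologicalSpace Y] {f : X → Y}

/-- The set of pairs of distinct points identified by a continuous locally injective map
is closed. -/
theorem isClosed_setOf_ne_and_apply_eq [T2Space Y] (hf : Continuous f)
    (hl : ∀ a, ∃ U ∈ 𝓝 a, InjOn f U) : IsClosed {p : X × X | p.1 ≠ p.2 ∧ f p.1 = f p.2} := by
  rw [← isOpen_compl_iff, isOpen_iff_mem_nhds]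
  rintro ⟨a, b⟩ hab
  by_cases h : f a = f b
  · obtain rfl : a = b := by
      by_contra hne
      exact hab ⟨hne, h⟩
    obtain ⟨U, hU, hinj⟩ := hl a
    filter_upwards [prod_mem_nhds hU hU] with p hp hq
    exact hq.1 (hinj hp.1 hp.2 hq.2)
  · have ho : IsOpen {p : X × X | f p.1 ≠ f p.2} :=
      isOpen_ne_fun (hf.comp continuous_fst) (hf.comp continuous_snd)
    filter_upwards [ho.mem_nhds h] with p hp hq
    exact hp hq.2

/-- A proper, open, locally injective map into a connected space is injective as soon as one
point has at most one preimage. -/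
theorem IsProperMap.injective_of_isOpenMap [T2Space X] [T2Space Y] [PreconnectedSpace Y]
    (hf : IsProperMap f) (ho : IsOpenMap f) (hl : ∀ a, ∃ U ∈ 𝓝 a, InjOn f U) {y₀ : Y}
    (hy₀ : ∀ a b, f a = y₀ → f b = y₀ → a = b) : Injective f := by
  set S : Set (X × X) := {p | p.1 ≠ p.2 ∧ f p.1 = f p.2}
  set A : Set Y := {y | ∃ a b, a ≠ b ∧ f a = y ∧ f b = y}
  have hAc : IsClosed A := by
    have hc : IsClosed (Prod.map f f '' S) :=
      (hf.prodMap hf).isClosedMap _ (isClosed_setOf_ne_and_apply_eq hf.continuous hl)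
    convert hc.preimage (continuous_id.prodMk continuous_id) using 1
    ext y
    constructor
    · rintro ⟨a, b, hne, rfl, hb⟩
      exact ⟨(a, b), ⟨hne, hb.symm⟩, Prod.ext rfl hb⟩
    · rintro ⟨⟨a, b⟩, ⟨hne, -⟩, h⟩
      exact ⟨a, b, hne, congrArg Prod.fst h, congrArg Prod.snd h⟩
  have hAo : IsOpen A := by
    rw [isOpen_iff_mem_nhds]
    rintro y ⟨a, b, hne, ha, hb⟩
    obtain ⟨U, V, hU, hV, haU, hbV, hUV⟩ := t2_separation hne
    filter_upwards [(ho U hU).mem_nhds ⟨a, haU, ha⟩, (ho V hV).mem_nhds ⟨b, hbV, hb⟩]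
    rintro z ⟨a', ha', rfl⟩ ⟨b', hb', h⟩
    exact ⟨a', b', hUV.ne_of_mem ha' hb', rfl, h⟩
  rcases isClopen_iff.1 ⟨hAc, hAo⟩ with h | h
  · intro a b hab
    by_contra hne
    exact (h ▸ (⟨a, b, hne, hab, rfl⟩ : f b ∈ A) : f b ∈ (∅ : Set Y))
  · obtain ⟨a, b, hne, ha, hb⟩ : y₀ ∈ A := h ▸ mem_univ y₀
    exact absurd (hy₀ a b ha hb) hne

theorem IsProperMap.surjective_of_isOpenMap [Nonempty X] [PreconnectedSpace Y]
    (hf : IsProperMap f) (ho : IsOpenMap f) : Surjective f :=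
  range_eq_univ.1 <| IsClopen.eq_univ ⟨hf.isClosedMap.isClosed_range, ho.isOpen_range⟩
    (range_nonempty f)

end ProperMaps

section BoundedDerivatives

variable {E F G : Type*} [NormedAddCommGroup E] [NormedSpace ℝ E]
  [NormedAddCommGroup F] [NormedSpace ℝ F] [NormedAddCommGroup G] [NormedSpace ℝ G]

/-- Boundedness of the derivatives of a composition, from bounds on the derivatives of the outer
map along the range of the inner one. -/
theorem exists_norm_iteratedFDeriv_comp_le {g : F → G} {f : E → F} {t : Set F} {k : ℕ}
    (ht : IsOpen t) (hft : ∀ x, f x ∈ t) (hg : ContDiffOn ℝ k g t) (hf : ContDiff ℝ k f)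
    (hgb : ∀ i ≤ k, ∃ C, ∀ x, ‖iteratedFDerivWithin ℝ i g t (f x)‖ ≤ C)
    (hfb : ∀ i, 1 ≤ i → i ≤ k → ∃ C, ∀ x, ‖iteratedFDeriv ℝ i f x‖ ≤ C) :
    ∃ C, ∀ x, ‖iteratedFDeriv ℝ k (g ∘ f) x‖ ≤ C := by
  have hgb' : ∀ i, ∃ C, i ≤ k → ∀ x, ‖iteratedFDerivWithin ℝ i g t (f x)‖ ≤ C := fun i => by
    by_cases h : i ≤ k
    · exact (hgb i h).imp fun C hC _ => hC
    · exact ⟨0, fun h' => absurd h' h⟩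
  have hfb' : ∀ i, ∃ C, 1 ≤ i → i ≤ k → ∀ x, ‖iteratedFDeriv ℝ i f x‖ ≤ C := fun i => by
    by_cases h : 1 ≤ i ∧ i ≤ k
    · exact (hfb i h.1 h.2).imp fun C hC _ _ => hC
    · exact ⟨0, fun h₁ h₂ => absurd ⟨h₁, h₂⟩ h⟩
  choose c hc using hgb'
  choose e he using hfb'
  obtain ⟨C, hC⟩ := ((finite_Iic k).image c).bddAbove
  obtain ⟨D, hD⟩ := ((finite_Iic k).image e).bddAbove
  refine ⟨k.factorial * C * (max 1 D) ^ k, fun x => ?_⟩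
  rw [← iteratedFDerivWithin_univ]
  refine norm_iteratedFDerivWithin_comp_le hg hf.contDiffOn le_rfl ht.uniqueDiffOn
    uniqueDiffOn_univ (fun x _ => hft x) (mem_univ x)
    (fun i hi => (hc i hi x).trans (hC (mem_image_of_mem c hi))) fun i h1 hi => ?_
  rw [iteratedFDerivWithin_univ]
  calc ‖iteratedFDeriv ℝ i f x‖ ≤ D := (he i h1 hi x).trans (hD (mem_image_of_mem e hi))
    _ ≤ max 1 D := le_max_right _ _
    _ ≤ (max 1 D) ^ i := le_self_pow₀ (le_max_left _ _) (by omega)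

/-- Boundedness of the derivatives of a composition whose inner map takes values in a compact
subset of the open set on which the outer map is smooth. -/
theorem exists_norm_iteratedFDeriv_comp_le_of_isCompact {g : F → G} {f : E → F} {t K : Set F}
    {k : ℕ} (ht : IsOpen t) (hK : IsCompact K) (hKt : K ⊆ t) (hfK : ∀ x, f x ∈ K)
    (hg : ContDiffOn ℝ k g t) (hf : ContDiff ℝ k f)
    (hfb : ∀ i, 1 ≤ i → i ≤ k → ∃ C, ∀ x, ‖iteratedFDeriv ℝ i f x‖ ≤ C) :
    ∃ C, ∀ x, ‖iteratedFDeriv ℝ k (g ∘ f) x‖ ≤ C := by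
  refine exists_norm_iteratedFDeriv_comp_le ht (fun x => hKt (hfK x)) hg hf (fun i hi => ?_) hfb
  obtain ⟨C, hC⟩ := hK.exists_bound_of_continuousOn
    ((hg.continuousOn_iteratedFDerivWithin (mod_cast hi) ht.uniqueDiffOn).mono hKt)
  exact ⟨C, fun x => hC _ (hfK x)⟩

/-- If `fderiv ψ = g ∘ ψ` with `g` having bounded derivatives of order less than `n`, then the
derivatives of `ψ` of order `1, …, n` are bounded. -/
theorem exists_norm_iteratedFDeriv_le_of_fderiv_eq_comp {ψ : E → F} {g : F → E →L[ℝ] F} {n : ℕ}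
    (hψ : ContDiff ℝ n ψ) (hg : ∀ k < n, ContDiff ℝ k g) (hψg : fderiv ℝ ψ = g ∘ ψ)
    (hgb : ∀ k < n, ∃ C, ∀ x, ‖iteratedFDeriv ℝ k g x‖ ≤ C) (l : ℕ) (hl : 1 ≤ l) (hln : l ≤ n) :
    ∃ C, ∀ x, ‖iteratedFDeriv ℝ l ψ x‖ ≤ C := by
  induction l using Nat.strong_induction_on with
  | _ l ih =>
    obtain ⟨k, rfl⟩ : ∃ k, l = k + 1 := ⟨l - 1, by omega⟩
    simp_rw [← norm_iteratedFDeriv_fderiv, hψg]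
    refine exists_norm_iteratedFDeriv_comp_le isOpen_univ (fun x => mem_univ _)
      (hg k (by omega)).contDiffOn (hψ.of_le (mod_cast by omega)) (fun i hi => ?_)
      fun i h1 hi => ih i (by omega) h1 (by omega)
    obtain ⟨C, hC⟩ := hgb i (by omega)
    exact ⟨C, fun x => by simpa only [iteratedFDerivWithin_univ] using hC (ψ x)⟩

end BoundedDerivatives

section PerturbationOfIdentity

/-- A continuous map at bounded distance from the identity is proper. -/
theorem isProperMap_of_norm_sub_le {E : Type*} [NormedAddCommGroup E] [ProperSpace E]
    {Φ : E → E} (hΦ : Continuous Φ) {M : ℝ} (hM : ∀ x, ‖Φ x - x‖ ≤ M) : IsProperMap Φ := by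
  refine isProperMap_iff_tendsto_cocompact.2 ⟨hΦ, ?_⟩
  rw [← Metric.cobounded_eq_cocompact, ← tendsto_norm_atTop_iff_cobounded]
  refine tendsto_atTop_mono (fun x => ?_)
    (tendsto_atTop_add_const_right _ (-M) tendsto_norm_cobounded_atTop)
  have h := norm_sub_norm_le x (Φ x)
  rw [norm_sub_rev] at h
  linarith [hM x]

variable {E : Type*} [NormedAddCommGroup E] [NormedSpace ℝ E] {Φ : E → E}

/-- If `Φ - id` is bounded and its derivative vanishes at infinity, some point has at most one
preimage under `Φ`. -/
theorem exists_forall_apply_eq_imp_eq [ProperSpace E] {M : ℝ} (hM : ∀ x, ‖Φ x - x‖ ≤ M)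
    (hd : Differentiable ℝ fun x => Φ x - x)
    (h0 : Tendsto (fderiv ℝ fun x => Φ x - x) (cocompact E) (𝓝 0)) :
    ∃ y₀, ∀ a b, Φ a = y₀ → Φ b = y₀ → a = b := by
  rcases subsingleton_or_nontrivial E with hE | hE
  · exact ⟨0, fun a b _ _ => Subsingleton.elim a b⟩
  have hev : ∀ᶠ x in Bornology.cobounded E, ‖fderiv ℝ (fun x => Φ x - x) x‖ ≤ 1 / 2 := by
    rw [Metric.cobounded_eq_cocompact]
    exact (tendsto_zero_iff_norm_tendsto_zero.1 h0).eventually_le_const (by norm_num)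
  obtain ⟨R, -, hR⟩ := hasBasis_cobounded_norm.eventually_iff.1 hev
  obtain ⟨y, hy⟩ := NormedSpace.exists_lt_norm ℝ E (R + M)
  have hball : ∀ x ∈ Metric.closedBall y M, ‖fderiv ℝ (fun x => Φ x - x) x‖ ≤ 1 / 2 := by
    intro x hx
    refine hR ?_
    rw [mem_closedBall_iff_norm'] at hx
    have h := norm_sub_norm_le y x
    simp only [mem_ofPred_eq]
    linarith
  have hmem : ∀ x, Φ x = y → x ∈ Metric.closedBall y M := by
    rintro x rfl
    exact mem_closedBall_iff_norm'.2 (hM x)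
  refine ⟨y, fun a b ha hb => ?_⟩
  have h := (convex_closedBall y M).norm_image_sub_le_of_norm_fderiv_le
    (fun x _ => hd x) hball (hmem b hb) (hmem a ha)
  rw [ha, hb, sub_sub_sub_cancel_left, norm_sub_rev] at h
  exact sub_eq_zero.1 (norm_le_zero_iff.1 (by linarith))

/-- Global inversion: a local diffeomorphism `Φ` with `Φ - id` bounded and `fderiv (Φ - id)`
vanishing at infinity is bijective. -/
theorem bijective_of_tendsto_fderiv_sub_id [ProperSpace E] [CompleteSpace E] {M : ℝ}
    {Φ' : E → E ≃L[ℝ] E} (hΦ : ∀ x, HasStrictFDerivAt Φ (Φ' x : E →L[ℝ] E) x)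
    (hM : ∀ x, ‖Φ x - x‖ ≤ M)
    (h0 : Tendsto (fderiv ℝ fun x => Φ x - x) (cocompact E) (𝓝 0)) : Bijective Φ := by
  have hdiff : Differentiable ℝ Φ := fun x => (hΦ x).hasFDerivAt.differentiableAt
  have hproper : IsProperMap Φ := isProperMap_of_norm_sub_le hdiff.continuous hM
  have hopen : IsOpenMap Φ := isOpenMap_of_hasStrictFDerivAt_equiv hΦ
  obtain ⟨y₀, hy₀⟩ := exists_forall_apply_eq_imp_eq hM (hdiff.sub differentiable_id) h0
  refine ⟨hproper.injective_of_isOpenMap hopen (fun a => ?_) hy₀,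
    hproper.surjective_of_isOpenMap hopen⟩
  set e := (hΦ a).toOpenPartialHomeomorph Φ
  exact ⟨e.source, e.open_source.mem_nhds (hΦ a).mem_toOpenPartialHomeomorph_source, e.injOn⟩

/-- If `fderiv Φ` is invertible everywhere, tends to the identity at infinity, and has bounded
derivatives up to order `k`, then so does its pointwise inverse. -/
theorem exists_norm_iteratedFDeriv_inverse_le [CompleteSpace E] {k : ℕ} {f : E → E →L[ℝ] E}
    {f' : E → E ≃L[ℝ] E} (hff' : ∀ x, .id ℝ E + f x = (f' x : E →L[ℝ] E))
    (hf : ContDiff ℝ k f) (h0 : Tendsto f (cocompact E) (𝓝 0))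
    (hfb : ∀ i, 1 ≤ i → i ≤ k → ∃ C, ∀ x, ‖iteratedFDeriv ℝ i f x‖ ≤ C) :
    ContDiff ℝ k (fun x => ((f' x).symm : E →L[ℝ] E)) ∧
      ∃ C, ∀ x, ‖iteratedFDeriv ℝ k (fun x => ((f' x).symm : E →L[ℝ] E)) x‖ ≤ C := by
  set t : Set (E →L[ℝ] E) := (fun A => .id ℝ E + A) ⁻¹' range ((↑) : (E ≃L[ℝ] E) → E →L[ℝ] E)
  have ht : IsOpen t := ContinuousLinearEquiv.isOpen.preimage (continuous_const.add continuous_id)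
  have hft : ∀ x, f x ∈ t := fun x => ⟨f' x, (hff' x).symm⟩
  set g : (E →L[ℝ] E) → E →L[ℝ] E := fun A => (ContinuousLinearMap.id ℝ E + A).inverse
  have hg : ContDiffOn ℝ k g t := by
    rintro A ⟨e, he⟩
    have hinv := contDiffAt_map_inverse (n := (k : WithTop ℕ∞)) e
    rw [he] at hinv
    exact (hinv.comp A (contDiffAt_const.add contDiffAt_id)).contDiffWithinAt
  have hgf : (fun x => ((f' x).symm : E →L[ℝ] E)) = g ∘ f := by
    funext x
    simp [g, hff' x]
  rw [hgf]
  refine ⟨hg.comp_contDiff hf hft, exists_norm_iteratedFDeriv_comp_le_of_isCompact ht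
    (h0.isCompact_insert_range_of_cocompact hf.continuous) ?_
    (fun x => mem_insert_of_mem _ (mem_range_self x)) hg hf hfb⟩
  refine insert_subset ⟨.refl ℝ E, ?_⟩ (range_subset_iff.2 hft)
  ext x
  simp

end PerturbationOfIdentity

section HolderSpace

variable {E F : Type*} [NormedAddCommGroup E] [NormedSpace ℝ E]
  [NormedAddCommGroup F] [NormedSpace ℝ F] {n : ℕ} {α : ℝ} {f : E → F}

theorem MemCb.exists_norm_iteratedFDeriv_le (hf : MemCb n α f) {l : ℕ} (hl : l ≤ n) :
    ∃ C, ∀ x, ‖iteratedFDeriv ℝ l f x‖ ≤ C := by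
  have hfin : eCnb n f < ⊤ := (le_max_left _ _).trans_lt hf.2
  refine ⟨(eCnb n f).toReal, fun x => ?_⟩
  have hle : (‖iteratedFDeriv ℝ l f x‖₊ : ℝ≥0∞) ≤ eCnb n f :=
    le_iSup₂_of_le (f := fun (l : Fin (n + 1)) (x : E) =>
      (‖iteratedFDeriv ℝ (l : ℕ) f x‖₊ : ℝ≥0∞)) ⟨l, Nat.lt_succ_of_le hl⟩ x le_rfl
  simpa using ENNReal.toReal_mono hfin.ne hle

theorem MemC0.tendsto_fderiv (hf : MemC0 n α f) (hn : 1 ≤ n) :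
    Tendsto (fderiv ℝ f) (cocompact E) (𝓝 0) := by
  rw [tendsto_zero_iff_norm_tendsto_zero]
  simpa only [norm_iteratedFDeriv_one] using hf.2 1 hn

end HolderSpace

/-- every `Φ ∈ D^{n,β}(ℝ^d)` is a `Cⁿ`-diffeomorphism of `ℝ^d`
and the derivatives of order `1, …, n` of `Φ⁻¹` are globally bounded. -/
theorem stmt7 (d n : ℕ) (hn : 1 ≤ n) (β : ℝ) (hβ0 : 0 < β) (hβ1 : β ≤ 1)
    (Φ : Euc d → Euc d) (hΦ : MemD d n β Φ) :
    Function.Bijective Φ ∧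
    ContDiff ℝ (n : ℕ∞) (Function.invFun Φ) ∧
    ∀ l : ℕ, 1 ≤ l → l ≤ n →
      ∃ C : ℝ, ∀ x, ‖iteratedFDeriv ℝ l (Function.invFun Φ) x‖ ≤ C := by
  obtain ⟨hφ, hdet⟩ := hΦ
  set φ : Euc d → Euc d := fun x => Φ x - x with hφ_def
  have hφs : ContDiff ℝ n φ := hφ.1.1
  have hΦs : ContDiff ℝ n Φ := by
    convert contDiff_id.add hφs using 1
    funext x
    simp [hφ_def]
  have hn0 : (n : WithTop ℕ∞) ≠ 0 := by
    have : n ≠ 0 := by omega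
    exact_mod_cast this
  set Φ' : Euc d → Euc d ≃L[ℝ] Euc d := fun x =>
    (fderiv ℝ Φ x).toContinuousLinearEquivOfDetNeZero (hdet x).ne' with hΦ'_def
  have hΦ' : ∀ x, (Φ' x : Euc d →L[ℝ] Euc d) = fderiv ℝ Φ x := fun x => by simp [hΦ'_def]
  have hstrict : ∀ x, HasStrictFDerivAt Φ (Φ' x : Euc d →L[ℝ] Euc d) x := fun x => by
    rw [hΦ']
    exact hΦs.contDiffAt.hasStrictFDerivAt hn0
  obtain ⟨M, hM⟩ := hφ.1.exists_norm_iteratedFDeriv_le (Nat.zero_le n)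
  simp only [norm_iteratedFDeriv_zero] at hM
  have h0 := hφ.tendsto_fderiv hn
  have hbij : Bijective Φ := bijective_of_tendsto_fderiv_sub_id hstrict hM h0
  set e : Euc d ≃ₜ Euc d := (Equiv.ofBijective Φ hbij).toHomeomorphOfContinuousOpen
    hΦs.continuous (isOpenMap_of_hasStrictFDerivAt_equiv hstrict)
  have hinv : invFun Φ = e.symm := by
    funext y
    exact hbij.1 ((rightInverse_invFun hbij.2 y).trans (e.apply_symm_apply y).symm)
  have hes : ContDiff ℝ n e.symm := e.contDiff_symm (fun x => (hstrict x).hasFDerivAt) hΦs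
  have hfderiv : fderiv ℝ e.symm = (fun x => ((Φ' x).symm : Euc d →L[ℝ] Euc d)) ∘ e.symm := by
    funext y
    exact (HasFDerivAt.of_local_left_inverse e.symm.continuous.continuousAt
      (hstrict _).hasFDerivAt (.of_forall e.apply_symm_apply)).fderiv
  have hsum : ∀ x, .id ℝ (Euc d) + fderiv ℝ φ x = (Φ' x : Euc d →L[ℝ] Euc d) := fun x => by
    rw [hΦ', hφ_def, fderiv_fun_sub (hΦs.differentiable hn0 x) differentiableAt_fun_id,
      fderiv_fun_id]
    abel
  have hG := fun k (hk : k < n) => exists_norm_iteratedFDeriv_inverse_le (k := k) hsum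
    (hφs.fderiv_right (mod_cast hk)) h0 fun i _ hi => by
      simp_rw [norm_iteratedFDeriv_fderiv]
      exact hφ.1.exists_norm_iteratedFDeriv_le (by omega)
  rw [hinv]
  exact ⟨hbij, hes, exists_norm_iteratedFDeriv_le_of_fderiv_eq_comp hes
    (fun k hk => (hG k hk).1) hfderiv fun k hk => (hG k hk).2⟩
end

section
/- Let n ∈ ℕ with n ≥ 1 and β ∈ (0,1]. Then D^{n,β}(ℝ^d) is a group under composition: if Φ, Ψ ∈ D^{n,β}(ℝ^d), then Φ∘Ψ ∈ D^{n,β}(ℝ^d) and Φ⁻¹ ∈ D^{n,β}(ℝ^d). Moreover, the chart representation of inversion, inv_c : φ ↦ (Id+φ)⁻¹ − Id, defined on the open set D^{n,β}(ℝ^d) − Id ⊆ C^{n,β}_0(ℝ^d,ℝ^d), is locally bounded: every φ₀ ∈ D^{n,β}(ℝ^d) − Id has a norm-‖·‖_{n,β} neighborhood whose image under inv_c is bounded in C^{n,β}_0(ℝ^d,ℝ^d). -/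
open Function Set Filter Topology MeasureTheory
open scoped ENNReal NNReal

section UniformHolder

universe u

variable {ι : Type*} {E : Type u} [NormedAddCommGroup E] [NormedSpace ℝ E]

/-- A family of maps is uniformly bounded in `C^{n,α}_b`; defined by recursion on `n`
through the derivative. -/
def UniformHolder (α : ℝ) : (n : ℕ) → {F : Type u} → [NormedAddCommGroup F] → [NormedSpace ℝ F] →
    (ι → E → F) → Prop
  | 0, _, _, _, f => (∃ K : ℝ, ∀ i x, ‖f i x‖ ≤ K) ∧
      ∃ K : ℝ, ∀ i x y, ‖f i x - f i y‖ ≤ K * ‖x - y‖ ^ α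
  | n + 1, _, _, _, f => (∃ K : ℝ, ∀ i x, ‖f i x‖ ≤ K) ∧ (∀ i, Differentiable ℝ (f i)) ∧
      UniformHolder α n (fun i => fderiv ℝ (f i))

/-- All derivatives of order at most `n` tend to zero at infinity; defined by recursion on `n`
through the derivative. -/
def DecaysToOrder : (n : ℕ) → {F : Type u} → [NormedAddCommGroup F] → [NormedSpace ℝ F] →
    (E → F) → Prop
  | 0, _, _, _, f => Tendsto f (cocompact E) (𝓝 0)
  | n + 1, _, _, _, f => Tendsto f (cocompact E) (𝓝 0) ∧ DecaysToOrder n (fderiv ℝ f)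

variable {F G H : Type u} [NormedAddCommGroup F] [NormedSpace ℝ F]
  [NormedAddCommGroup G] [NormedSpace ℝ G] [NormedAddCommGroup H] [NormedSpace ℝ H]
  {α : ℝ} {n : ℕ}

namespace UniformHolder

theorem bounded {f : ι → E → F} (hf : UniformHolder α n f) :
    ∃ K : ℝ, 0 ≤ K ∧ ∀ i x, ‖f i x‖ ≤ K := by
  have : ∃ K : ℝ, ∀ i x, ‖f i x‖ ≤ K := by
    cases n with
    | zero => exact hf.1
    | succ n => exact hf.1
  obtain ⟨K, hK⟩ := this
  exact ⟨max K 0, le_max_right _ _, fun i x => (hK i x).trans (le_max_left _ _)⟩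

theorem differentiable {f : ι → E → F} (hf : UniformHolder α (n + 1) f) (i : ι) :
    Differentiable ℝ (f i) := hf.2.1 i

theorem fderiv {f : ι → E → F} (hf : UniformHolder α (n + 1) f) :
    UniformHolder α n (fun i => fderiv ℝ (f i)) := hf.2.2

theorem holder_const {f : ι → E → F} (hf : UniformHolder α 0 f) :
    ∃ K : ℝ, 0 ≤ K ∧ ∀ i x y, ‖f i x - f i y‖ ≤ K * ‖x - y‖ ^ α := by
  obtain ⟨K, hK⟩ := hf.2
  refine ⟨max K 0, le_max_right _ _, fun i x y => (hK i x y).trans ?_⟩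
  gcongr
  exact le_max_left _ _

theorem zero_of_lipschitz (hα0 : 0 < α) (hα1 : α ≤ 1) {f : ι → E → F} {K L : ℝ}
    (hK : ∀ i x, ‖f i x‖ ≤ K) (hL : ∀ i x y, ‖f i x - f i y‖ ≤ L * ‖x - y‖) :
    UniformHolder α 0 f := by
  refine ⟨⟨K, hK⟩, max (2 * K) L, fun i x y => ?_⟩
  have hK0 : 0 ≤ K := (norm_nonneg _).trans (hK i x)
  have hM0 : 0 ≤ max (2 * K) L := le_max_of_le_left (by positivity)
  rcases le_total ‖x - y‖ 1 with h | h
  · calc ‖f i x - f i y‖ ≤ L * ‖x - y‖ := hL i x y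
      _ ≤ max (2 * K) L * ‖x - y‖ := by gcongr; exact le_max_right _ _
      _ ≤ max (2 * K) L * ‖x - y‖ ^ α := by
        gcongr
        exact Real.self_le_rpow_of_le_one (norm_nonneg _) h hα1
  · calc ‖f i x - f i y‖ ≤ ‖f i x‖ + ‖f i y‖ := norm_sub_le _ _
      _ ≤ 2 * K := by linarith [hK i x, hK i y]
      _ ≤ max (2 * K) L * 1 := by rw [mul_one]; exact le_max_left _ _
      _ ≤ max (2 * K) L * ‖x - y‖ ^ α := by
        gcongr
        exact Real.one_le_rpow h hα0.le

theorem lipschitz {f : ι → E → F} (hf : UniformHolder α (n + 1) f) :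
    ∃ L : ℝ, 0 ≤ L ∧ ∀ i x y, ‖f i x - f i y‖ ≤ L * ‖x - y‖ := by
  obtain ⟨L, hL0, hL⟩ := hf.fderiv.bounded
  refine ⟨L, hL0, fun i x y => ?_⟩
  exact Convex.norm_image_sub_le_of_norm_fderiv_le (𝕜 := ℝ)
    (fun z _ => hf.differentiable i z) (fun z _ => hL i z) convex_univ (mem_univ y) (mem_univ x)

theorem of_succ (hα0 : 0 < α) (hα1 : α ≤ 1) {f : ι → E → F} (hf : UniformHolder α (n + 1) f) :
    UniformHolder α n f := by
  induction n generalizing F with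
  | zero =>
    obtain ⟨K, -, hK⟩ := hf.bounded
    obtain ⟨L, -, hL⟩ := hf.lipschitz
    exact zero_of_lipschitz hα0 hα1 hK hL
  | succ n ih => exact ⟨hf.1, hf.2.1, ih hf.fderiv⟩

theorem const (c : F) : UniformHolder α n (fun (_ : ι) (_ : E) => c) := by
  induction n generalizing F with
  | zero => exact ⟨⟨‖c‖, fun _ _ => le_rfl⟩, 0, by simp⟩
  | succ n ih =>
    refine ⟨⟨‖c‖, fun _ _ => le_rfl⟩, fun _ => differentiable_const c, ?_⟩
    convert ih (0 : E →L[ℝ] F) using 1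
    ext1 i
    exact fderiv_fun_const c

theorem bounded_add {f g : ι → E → F} (hf : UniformHolder α n f) (hg : UniformHolder α n g) :
    ∃ K : ℝ, ∀ i x, ‖f i x + g i x‖ ≤ K := by
  obtain ⟨K, -, hK⟩ := hf.bounded
  obtain ⟨L, -, hL⟩ := hg.bounded
  exact ⟨K + L, fun i x => (norm_add_le _ _).trans (add_le_add (hK i x) (hL i x))⟩

theorem add {f g : ι → E → F} (hf : UniformHolder α n f) (hg : UniformHolder α n g) :
    UniformHolder α n (fun i x => f i x + g i x) := by
  induction n generalizing F with
  | zero =>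
    refine ⟨bounded_add hf hg, ?_⟩
    obtain ⟨K, -, hK⟩ := hf.holder_const
    obtain ⟨L, -, hL⟩ := hg.holder_const
    refine ⟨K + L, fun i x y => ?_⟩
    rw [add_sub_add_comm, add_mul]
    exact (norm_add_le _ _).trans (add_le_add (hK i x y) (hL i x y))
  | succ n ih =>
    refine ⟨bounded_add hf hg, fun i => (hf.differentiable i).add (hg.differentiable i), ?_⟩
    have hfg : (fun i => _root_.fderiv ℝ (fun x => f i x + g i x)) =
        fun i x => _root_.fderiv ℝ (f i) x + _root_.fderiv ℝ (g i) x := by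
      ext1 i
      ext1 x
      exact fderiv_fun_add (hf.differentiable i x) (hg.differentiable i x)
    rw [hfg]
    exact ih hf.fderiv hg.fderiv

theorem bounded_bilinear (B : F →L[ℝ] G →L[ℝ] H) {f : ι → E → F} {g : ι → E → G}
    (hf : UniformHolder α n f) (hg : UniformHolder α n g) :
    ∃ K : ℝ, ∀ i x, ‖B (f i x) (g i x)‖ ≤ K := by
  obtain ⟨K, hK0, hK⟩ := hf.bounded
  obtain ⟨L, hL0, hL⟩ := hg.bounded
  refine ⟨‖B‖ * K * L, fun i x => (B.le_opNorm₂ _ _).trans ?_⟩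
  gcongr
  · exact hK i x
  · exact hL i x

theorem bilinear (hα0 : 0 < α) (hα1 : α ≤ 1) (B : F →L[ℝ] G →L[ℝ] H)
    {f : ι → E → F} {g : ι → E → G} (hf : UniformHolder α n f) (hg : UniformHolder α n g) :
    UniformHolder α n (fun i x => B (f i x) (g i x)) := by
  induction n generalizing F G H with
  | zero =>
    refine ⟨bounded_bilinear B hf hg, ?_⟩
    obtain ⟨K, hK0, hK⟩ := hf.bounded
    obtain ⟨L, hL0, hL⟩ := hg.bounded
    obtain ⟨K', hK'0, hK'⟩ := hf.holder_const
    obtain ⟨L', hL'0, hL'⟩ := hg.holder_const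
    refine ⟨‖B‖ * K * L' + ‖B‖ * K' * L, fun i x y => ?_⟩
    have hsplit : B (f i x) (g i x) - B (f i y) (g i y) =
        B (f i x) (g i x - g i y) + B (f i x - f i y) (g i y) := by
      simp
    rw [hsplit]
    calc _ ≤ ‖B (f i x) (g i x - g i y)‖ + ‖B (f i x - f i y) (g i y)‖ := norm_add_le _ _
      _ ≤ ‖B‖ * ‖f i x‖ * ‖g i x - g i y‖ + ‖B‖ * ‖f i x - f i y‖ * ‖g i y‖ :=
        add_le_add (B.le_opNorm₂ _ _) (B.le_opNorm₂ _ _)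
      _ ≤ ‖B‖ * K * (L' * ‖x - y‖ ^ α) + ‖B‖ * (K' * ‖x - y‖ ^ α) * L := by
        gcongr
        · exact hK i x
        · exact hL' i x y
        · exact hK' i x y
        · exact hL i y
      _ = _ := by ring
  | succ n ih =>
    have hd : ∀ i x, HasFDerivAt (fun x => B (f i x) (g i x))
        (B.precompR E (f i x) (_root_.fderiv ℝ (g i) x) +
          B.precompL E (_root_.fderiv ℝ (f i) x) (g i x)) x := fun i x =>
      B.hasFDerivAt_of_bilinear (hf.differentiable i x).hasFDerivAt
        (hg.differentiable i x).hasFDerivAt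
    refine ⟨bounded_bilinear B hf hg, fun i x => (hd i x).differentiableAt, ?_⟩
    have hfg : (fun i => _root_.fderiv ℝ (fun x => B (f i x) (g i x))) =
        fun i x => B.precompR E (f i x) (_root_.fderiv ℝ (g i) x) +
          B.precompL E (_root_.fderiv ℝ (f i) x) (g i x) := by
      ext1 i
      ext1 x
      exact (hd i x).fderiv
    rw [hfg]
    exact add (ih _ (hf.of_succ hα0 hα1) hg.fderiv) (ih _ hf.fderiv (hg.of_succ hα0 hα1))

theorem clm (hα0 : 0 < α) (hα1 : α ≤ 1) (L : F →L[ℝ] G) {f : ι → E → F}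
    (hf : UniformHolder α n f) : UniformHolder α n (fun i x => L (f i x)) :=
  bilinear hα0 hα1 (ContinuousLinearMap.id ℝ (F →L[ℝ] G)) (const L) hf

theorem neg (hα0 : 0 < α) (hα1 : α ≤ 1) {f : ι → E → F} (hf : UniformHolder α n f) :
    UniformHolder α n (fun i x => -f i x) :=
  clm hα0 hα1 (-ContinuousLinearMap.id ℝ F) hf

theorem sub (hα0 : 0 < α) (hα1 : α ≤ 1) {f g : ι → E → F} (hf : UniformHolder α n f)
    (hg : UniformHolder α n g) : UniformHolder α n (fun i x => f i x - g i x) := by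
  simpa only [sub_eq_add_neg] using hf.add (hg.neg hα0 hα1)

theorem reindex {κ : Type*} (e : κ → ι) {f : ι → E → F} (hf : UniformHolder α n f) :
    UniformHolder α n (fun k => f (e k)) := by
  induction n generalizing F with
  | zero =>
    obtain ⟨⟨K, hK⟩, L, hL⟩ := hf
    exact ⟨⟨K, fun k => hK (e k)⟩, L, fun k => hL (e k)⟩
  | succ n ih =>
    obtain ⟨⟨K, hK⟩, hd, h⟩ := hf
    exact ⟨⟨K, fun k => hK (e k)⟩, fun k => hd (e k), ih h⟩

/-- Composition with a uniformly Lipschitz family of maps `x ↦ x + ψ i x`. -/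
theorem comp_id_add (hα0 : 0 < α) (hα1 : α ≤ 1) {f : ι → E → F} {ψ : ι → E → E} {L : ℝ}
    (hL : ∀ i x y, ‖(x + ψ i x) - (y + ψ i y)‖ ≤ L * ‖x - y‖)
    (hf : UniformHolder α n f) (hψ : UniformHolder α n ψ) :
    UniformHolder α n (fun i x => f i (x + ψ i x)) := by
  induction n generalizing F with
  | zero =>
    obtain ⟨K, -, hK⟩ := hf.bounded
    obtain ⟨K', hK'0, hK'⟩ := hf.holder_const
    refine ⟨⟨K, fun i x => hK i _⟩, K' * max L 0 ^ α, fun i x y => (hK' i _ _).trans ?_⟩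
    rw [mul_assoc, ← Real.mul_rpow (le_max_right _ _) (norm_nonneg _)]
    gcongr
    exact (hL i x y).trans (by gcongr; exact le_max_left _ _)
  | succ n ih =>
    obtain ⟨K, -, hK⟩ := hf.bounded
    have hd : ∀ i x, HasFDerivAt (fun x => f i (x + ψ i x))
        ((_root_.fderiv ℝ (f i) (x + ψ i x)).comp
          (ContinuousLinearMap.id ℝ E + _root_.fderiv ℝ (ψ i) x)) x := fun i x =>
      (hf.differentiable i _).hasFDerivAt.comp x
        ((hasFDerivAt_id x).add (hψ.differentiable i x).hasFDerivAt)
    refine ⟨⟨K, fun i x => hK i _⟩, fun i x => (hd i x).differentiableAt, ?_⟩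
    have hfg : (fun i => _root_.fderiv ℝ (fun x => f i (x + ψ i x))) =
        fun i x => ContinuousLinearMap.compL ℝ E E F (_root_.fderiv ℝ (f i) (x + ψ i x))
          (ContinuousLinearMap.id ℝ E + _root_.fderiv ℝ (ψ i) x) := by
      ext1 i
      ext1 x
      exact (hd i x).fderiv
    rw [hfg]
    exact bilinear hα0 hα1 _ (ih hf.fderiv (hψ.of_succ hα0 hα1)) ((const _).add hψ.fderiv)

theorem ringInverse (hα0 : 0 < α) (hα1 : α ≤ 1) {R : Type u} [NormedRing R] [NormedAlgebra ℝ R]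
    [CompleteSpace R] {A I : ι → E → R} (hAI : ∀ i x, A i x * I i x = 1)
    (hIA : ∀ i x, I i x * A i x = 1) (hI : ∃ M : ℝ, ∀ i x, ‖I i x‖ ≤ M)
    (hA : UniformHolder α n A) : UniformHolder α n I := by
  induction n with
  | zero =>
    refine ⟨hI, ?_⟩
    obtain ⟨M, hM⟩ := hI
    obtain ⟨K, hK0, hK⟩ := hA.holder_const
    refine ⟨M * K * M, fun i x y => ?_⟩
    have hM0 : 0 ≤ M := (norm_nonneg _).trans (hM i x)
    have hsplit : I i x - I i y = I i x * (A i y - A i x) * I i y := by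
      rw [mul_sub, sub_mul, mul_assoc, hAI, mul_one, hIA, one_mul]
    rw [hsplit]
    calc _ ≤ ‖I i x‖ * ‖A i y - A i x‖ * ‖I i y‖ :=
          (norm_mul_le _ _).trans (by gcongr; exact norm_mul_le _ _)
      _ ≤ M * (K * ‖x - y‖ ^ α) * M := by
        gcongr
        · exact hM i x
        · rw [norm_sub_rev]; exact hK i x y
        · exact hM i y
      _ = _ := by ring
  | succ n ih =>
    have hI' : UniformHolder α n I := ih (hA.of_succ hα0 hα1)
    have hd : ∀ i x, HasFDerivAt (I i)
        ((-ContinuousLinearMap.mulLeftRight ℝ R (I i x) (I i x)).comp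
          (_root_.fderiv ℝ (A i) x)) x := by
      intro i x
      have hinv : I i = fun y => Ring.inverse (A i y) := by
        ext1 y
        exact (Ring.inverse_unit (⟨A i y, I i y, hAI i y, hIA i y⟩ : Rˣ)).symm
      have h : HasFDerivAt (fun y => Ring.inverse (A i y))
          ((-ContinuousLinearMap.mulLeftRight ℝ R (I i x) (I i x)).comp
            (_root_.fderiv ℝ (A i) x)) x :=
        (hasFDerivAt_ringInverse (𝕜 := ℝ)
          (⟨A i x, I i x, hAI i x, hIA i x⟩ : Rˣ)).comp x (hA.differentiable i x).hasFDerivAt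
      rwa [← hinv] at h
    refine ⟨hI, fun i x => (hd i x).differentiableAt, ?_⟩
    have hfg : (fun i => _root_.fderiv ℝ (I i)) =
        fun i x => ContinuousLinearMap.compL ℝ E R R
          (-ContinuousLinearMap.mulLeftRight ℝ R (I i x) (I i x)) (_root_.fderiv ℝ (A i) x) := by
      ext1 i
      ext1 x
      exact (hd i x).fderiv
    rw [hfg]
    exact bilinear hα0 hα1 _ ((bilinear hα0 hα1 _ hI' hI').neg hα0 hα1) hA.fderiv

end UniformHolder

namespace DecaysToOrder

theorem tendsto {f : E → F} (hf : DecaysToOrder n f) : Tendsto f (cocompact E) (𝓝 0) := by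
  cases n with
  | zero => exact hf
  | succ n => exact hf.1

theorem of_succ {f : E → F} (hf : DecaysToOrder (n + 1) f) : DecaysToOrder n f := by
  induction n generalizing F with
  | zero => exact hf.1
  | succ n ih => exact ⟨hf.1, ih hf.2⟩

theorem add {f g : E → F}
    (hfu : UniformHolder α n (fun _ : Unit => f)) (hgu : UniformHolder α n (fun _ : Unit => g))
    (hf : DecaysToOrder n f) (hg : DecaysToOrder n g) :
    DecaysToOrder n (fun x => f x + g x) := by
  have ht : Tendsto (fun x => f x + g x) (cocompact E) (𝓝 0) := by
    simpa using hf.tendsto.add hg.tendsto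
  induction n generalizing F with
  | zero => exact ht
  | succ n ih =>
    have hfg : _root_.fderiv ℝ (fun x => f x + g x) =
        fun x => _root_.fderiv ℝ f x + _root_.fderiv ℝ g x := by
      ext1 x
      exact fderiv_fun_add (hfu.differentiable () x) (hgu.differentiable () x)
    refine ⟨ht, ?_⟩
    rw [hfg]
    exact ih hfu.fderiv hgu.fderiv hf.2 hg.2 (by simpa using hf.2.tendsto.add hg.2.tendsto)

theorem tendsto_bilinear (B : F →L[ℝ] G →L[ℝ] H) {f : E → F} {g : E → G}
    (hgu : UniformHolder α n (fun _ : Unit => g)) (hf : DecaysToOrder n f) :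
    Tendsto (fun x => B (f x) (g x)) (cocompact E) (𝓝 0) := by
  obtain ⟨K, hK0, hK⟩ := hgu.bounded
  refine squeeze_zero_norm (a := fun x => ‖B‖ * ‖f x‖ * K) (fun x => ?_) ?_
  · refine (B.le_opNorm₂ _ _).trans ?_
    gcongr
    exact hK () x
  · simpa using (hf.tendsto.norm.const_mul ‖B‖).mul_const K

theorem bilinear (hα0 : 0 < α) (hα1 : α ≤ 1) (B : F →L[ℝ] G →L[ℝ] H) {f : E → F} {g : E → G}
    (hfu : UniformHolder α n (fun _ : Unit => f)) (hgu : UniformHolder α n (fun _ : Unit => g))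
    (hf : DecaysToOrder n f) : DecaysToOrder n (fun x => B (f x) (g x)) := by
  induction n generalizing F G H with
  | zero => exact tendsto_bilinear B hgu hf
  | succ n ih =>
    have hfg : _root_.fderiv ℝ (fun x => B (f x) (g x)) =
        fun x => B.precompR E (f x) (_root_.fderiv ℝ g x) +
          B.precompL E (_root_.fderiv ℝ f x) (g x) := by
      ext1 x
      exact B.fderiv_of_bilinear (hfu.differentiable () x) (hgu.differentiable () x)
    refine ⟨tendsto_bilinear B hgu hf, ?_⟩
    rw [hfg]
    have hfu' := hfu.of_succ hα0 hα1
    have hgu' := hgu.of_succ hα0 hα1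
    exact add (UniformHolder.bilinear hα0 hα1 (B.precompR E) hfu' hgu.fderiv)
      (UniformHolder.bilinear hα0 hα1 (B.precompL E) hfu.fderiv hgu')
      (ih _ hfu' hgu.fderiv hf.of_succ) (ih _ hfu.fderiv hgu' hf.2)

theorem neg {f : E → F} (hf : DecaysToOrder n f) : DecaysToOrder n (fun x => -f x) := by
  have ht : Tendsto (fun x => -f x) (cocompact E) (𝓝 0) := by simpa using hf.tendsto.neg
  induction n generalizing F with
  | zero => exact ht
  | succ n ih =>
    refine ⟨ht, ?_⟩
    have hfg : _root_.fderiv ℝ (fun x => -f x) = fun x => -_root_.fderiv ℝ f x := by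
      ext1 x
      exact fderiv_fun_neg
    rw [hfg]
    exact ih hf.2 (by simpa using hf.2.tendsto.neg)

theorem comp_id_add (hα0 : 0 < α) (hα1 : α ≤ 1) {f : E → F} {ψ : E → E} {L : ℝ}
    (hL : ∀ x y, ‖(x + ψ x) - (y + ψ y)‖ ≤ L * ‖x - y‖)
    (hfu : UniformHolder α n (fun _ : Unit => f)) (hψu : UniformHolder α n (fun _ : Unit => ψ))
    (hψt : Tendsto (fun x => x + ψ x) (cocompact E) (cocompact E))
    (hf : DecaysToOrder n f) : DecaysToOrder n (fun x => f (x + ψ x)) := by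
  induction n generalizing F with
  | zero => exact hf.tendsto.comp hψt
  | succ n ih =>
    have hfg : _root_.fderiv ℝ (fun x => f (x + ψ x)) =
        fun x => ContinuousLinearMap.compL ℝ E E F (_root_.fderiv ℝ f (x + ψ x))
          (ContinuousLinearMap.id ℝ E + _root_.fderiv ℝ ψ x) := by
      ext1 x
      exact ((hfu.differentiable () _).hasFDerivAt.comp x
        ((hasFDerivAt_id x).add (hψu.differentiable () x).hasFDerivAt)).fderiv
    refine ⟨hf.tendsto.comp hψt, ?_⟩
    rw [hfg]
    have hψu' := hψu.of_succ hα0 hα1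
    exact bilinear hα0 hα1 _
      (UniformHolder.comp_id_add hα0 hα1 (fun _ => hL) hfu.fderiv hψu')
      ((UniformHolder.const _).add hψu.fderiv) (ih hfu.fderiv hψu' hf.2)

end DecaysToOrder

theorem norm_iteratedFDeriv_succ_sub (f : E → F) (x y : E) :
    ‖iteratedFDeriv ℝ (n + 1) f x - iteratedFDeriv ℝ (n + 1) f y‖ =
      ‖iteratedFDeriv ℝ n (fderiv ℝ f) x - iteratedFDeriv ℝ n (fderiv ℝ f) y‖ := by
  rw [iteratedFDeriv_succ_eq_comp_right, iteratedFDeriv_succ_eq_comp_right,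
    ← dist_eq_norm, ← dist_eq_norm]
  exact (continuousMultilinearCurryRightEquiv' ℝ n E F).symm.dist_map _ _

theorem norm_iteratedFDeriv_zero_sub (f : E → F) (x y : E) :
    ‖iteratedFDeriv ℝ 0 f x - iteratedFDeriv ℝ 0 f y‖ = ‖f x - f y‖ := by
  rw [iteratedFDeriv_zero_eq_comp, Function.comp_apply, Function.comp_apply, ← map_sub,
    LinearIsometryEquiv.norm_map]

omit [NormedSpace ℝ E] [NormedSpace ℝ F] in
theorem continuous_of_holder {f : E → F} (hα0 : 0 < α) {K : ℝ}
    (h : ∀ x y, ‖f x - f y‖ ≤ K * ‖x - y‖ ^ α) : Continuous f := by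
  rw [continuous_iff_continuousAt]
  intro y
  rw [ContinuousAt, tendsto_iff_norm_sub_tendsto_zero]
  refine squeeze_zero (fun _ => norm_nonneg _) (fun x => h x y) ?_
  have hc : Continuous fun x : E => K * ‖x - y‖ ^ α :=
    continuous_const.mul
      ((continuous_id.sub continuous_const).norm.rpow_const fun _ => Or.inr hα0.le)
  have := hc.tendsto y
  simpa [Real.zero_rpow hα0.ne'] using this

theorem uniformHolder_iff_iteratedFDeriv (hα0 : 0 < α) {f : ι → E → F} :
    UniformHolder α n f ↔ (∀ i, ContDiff ℝ n (f i)) ∧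
      (∃ K : ℝ, ∀ i, ∀ l ≤ n, ∀ x, ‖iteratedFDeriv ℝ l (f i) x‖ ≤ K) ∧
      ∃ K : ℝ, ∀ i x y,
        ‖iteratedFDeriv ℝ n (f i) x - iteratedFDeriv ℝ n (f i) y‖ ≤ K * ‖x - y‖ ^ α := by
  induction n generalizing F with
  | zero =>
    simp only [norm_iteratedFDeriv_zero_sub, Nat.le_zero, forall_eq, norm_iteratedFDeriv_zero,
      CharP.cast_eq_zero, contDiff_zero]
    refine ⟨fun h => ⟨fun i => ?_, h⟩, fun h => h.2⟩
    obtain ⟨-, K, hK⟩ := h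
    exact continuous_of_holder hα0 (hK i)
  | succ n ih =>
    simp only [norm_iteratedFDeriv_succ_sub, Nat.cast_add, Nat.cast_one, contDiff_succ_iff_fderiv]
    constructor
    · rintro ⟨⟨K, hK⟩, hd, h⟩
      obtain ⟨hc, ⟨K', hK'⟩, hL⟩ := ih.1 h
      refine ⟨fun i => ⟨hd i, by simp, hc i⟩, ⟨max K K', ?_⟩, hL⟩
      intro i l hl x
      cases l with
      | zero => simpa using Or.inl (hK i x)
      | succ l =>
        rw [← norm_iteratedFDeriv_fderiv]
        exact (hK' i l (by omega) x).trans (le_max_right _ _)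
    · rintro ⟨hc, ⟨K, hK⟩, hL⟩
      refine ⟨⟨K, fun i x => by simpa using hK i 0 (Nat.zero_le _) x⟩, fun i => (hc i).1, ?_⟩
      refine ih.2 ⟨fun i => (hc i).2.2, ⟨K, fun i l hl x => ?_⟩, hL⟩
      rw [norm_iteratedFDeriv_fderiv]
      exact hK i (l + 1) (by omega) x

theorem eCnb_le_iff {f : E → F} {K : ℝ≥0} :
    eCnb n f ≤ K ↔ ∀ l ≤ n, ∀ x, ‖iteratedFDeriv ℝ l f x‖ ≤ K := by
  simp only [eCnb, iSup_le_iff, ENNReal.coe_le_coe, ← NNReal.coe_le_coe, coe_nnnorm]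
  exact ⟨fun h l hl => h ⟨l, Nat.lt_succ_of_le hl⟩, fun h l => h l (Nat.le_of_lt_succ l.2)⟩

theorem eHsemi_le_iff (hα0 : 0 < α) {f : E → F} {K : ℝ≥0} :
    eHsemi n α f ≤ K ↔
      ∀ x y, ‖iteratedFDeriv ℝ n f x - iteratedFDeriv ℝ n f y‖ ≤ K * ‖x - y‖ ^ α := by
  simp only [eHsemi, iSup_le_iff]
  refine forall_congr' fun x => forall_congr' fun y => ?_
  by_cases hxy : x = y
  · simp [hxy, Real.zero_rpow hα0.ne']
  · have hne : nndist x y ^ α ≠ 0 := by simp [hxy, hα0.ne']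
    simp only [ne_eq, hxy, not_false_eq_true, forall_true_left]
    rw [edist_nndist, ← ENNReal.coe_rpow_of_nonneg _ hα0.le, ENNReal.div_le_iff
      (by exact_mod_cast hne) ENNReal.coe_ne_top, ← ENNReal.coe_mul, ENNReal.coe_le_coe,
      ← NNReal.coe_le_coe]
    simp [dist_eq_norm]

theorem uniformHolder_iff_eHnorm (hα0 : 0 < α) {f : ι → E → F} :
    UniformHolder α n f ↔ (∀ i, ContDiff ℝ (n : ℕ∞) (f i)) ∧
      ∃ K : ℝ≥0, ∀ i, eHnorm n α (f i) ≤ K := by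
  rw [uniformHolder_iff_iteratedFDeriv hα0]
  simp only [eHnorm, max_le_iff, eCnb_le_iff, eHsemi_le_iff hα0]
  refine and_congr Iff.rfl ⟨?_, ?_⟩
  · rintro ⟨⟨K, hK⟩, L, hL⟩
    refine ⟨(max K L).toNNReal, fun i => ⟨fun l hl x => (hK i l hl x).trans ?_,
      fun x y => (hL i x y).trans ?_⟩⟩
    · exact (le_max_left _ _).trans (Real.le_coe_toNNReal _)
    · gcongr
      exact (le_max_right _ _).trans (Real.le_coe_toNNReal _)
  · rintro ⟨K, hK⟩
    exact ⟨⟨K, fun i => (hK i).1⟩, K, fun i => (hK i).2⟩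

theorem memCb_iff_uniformHolder (hα0 : 0 < α) {f : E → F} :
    MemCb n α f ↔ UniformHolder α n (fun _ : Unit => f) := by
  rw [uniformHolder_iff_eHnorm hα0, MemCb, ENNReal.lt_iff_exists_coe]
  simp only [forall_const]
  refine and_congr Iff.rfl ⟨?_, ?_⟩
  · rintro ⟨K, hK, -⟩
    exact ⟨K, hK.le⟩
  · rintro ⟨K, hK⟩
    exact ENNReal.lt_iff_exists_coe.1 (hK.trans_lt ENNReal.coe_lt_top)

theorem decaysToOrder_iff {f : E → F} :
    DecaysToOrder n f ↔
      ∀ l ≤ n, Tendsto (fun x => ‖iteratedFDeriv ℝ l f x‖) (cocompact E) (𝓝 0) := by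
  induction n generalizing F with
  | zero =>
    simp only [Nat.le_zero, forall_eq, norm_iteratedFDeriv_zero]
    exact tendsto_zero_iff_norm_tendsto_zero
  | succ n ih =>
    rw [DecaysToOrder, ih, tendsto_zero_iff_norm_tendsto_zero]
    simp only [norm_iteratedFDeriv_fderiv]
    constructor
    · rintro ⟨h0, h⟩ l hl
      cases l with
      | zero => simpa using h0
      | succ l => exact h l (by omega)
    · intro h
      exact ⟨by simpa using h 0 (Nat.zero_le _), fun l hl => h (l + 1) (by omega)⟩

theorem memC0_iff (hα0 : 0 < α) {f : E → F} :
    MemC0 n α f ↔ UniformHolder α n (fun _ : Unit => f) ∧ DecaysToOrder n f := by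
  rw [MemC0, memCb_iff_uniformHolder hα0, decaysToOrder_iff]

theorem hnorm_le_of_eHnorm_le {f : E → F} {K : ℝ≥0} (h : eHnorm n α f ≤ K) : hnorm n α f ≤ K :=
  ENNReal.toReal_le_coe_of_le_coe h

omit [NormedSpace ℝ E] in
theorem tendsto_id_add_cocompact [ProperSpace E] {ψ : E → E} {K : ℝ} (hK : ∀ x, ‖ψ x‖ ≤ K) :
    Tendsto (fun x => x + ψ x) (cocompact E) (cocompact E) := by
  rw [← Metric.cobounded_eq_cocompact, ← tendsto_norm_atTop_iff_cobounded]
  refine tendsto_atTop_mono (f := fun x => ‖x‖ - K) (fun x => ?_)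
    (tendsto_atTop_add_const_right _ _ tendsto_norm_cobounded_atTop)
  have := norm_sub_le (x + ψ x) (ψ x)
  rw [add_sub_cancel_right] at this
  linarith [hK x]

/-- A proper local homeomorphism of a space onto a connected space is injective as soon as
one fibre is a subsingleton. -/
theorem injective_of_isProperMap {X Y : Type*} [TopologicalSpace X] [TopologicalSpace Y]
    [T2Space X] [T2Space Y] [PreconnectedSpace Y] {Φ : X → Y} (hp : IsProperMap Φ)
    (ho : IsOpenMap Φ) (hl : ∀ x, ∃ U ∈ 𝓝 x, InjOn Φ U) {y₀ : Y}
    (hy₀ : ∀ a b, Φ a = y₀ → Φ b = y₀ → a = b) : Function.Injective Φ := by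
  set S : Set (X × X) := {p | Φ p.1 = Φ p.2 ∧ p.1 ≠ p.2} with hS
  set A : Set Y := {y | ∃ a b, a ≠ b ∧ Φ a = y ∧ Φ b = y} with hA
  have hAo : IsOpen A := by
    have h1 : IsOpen (Prod.map Φ Φ '' {p : X × X | p.1 ≠ p.2}) :=
      (ho.prodMap ho) _ (isOpen_ne_fun continuous_fst continuous_snd)
    convert h1.preimage (continuous_id.prodMk continuous_id : Continuous fun y : Y => (y, y)) using 1
    ext y
    simp [hA, Prod.ext_iff]
  have hSc : IsClosed S := by
    rw [← isOpen_compl_iff, isOpen_iff_mem_nhds]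
    rintro ⟨a, b⟩ hab
    by_cases h : a = b
    · subst h
      obtain ⟨U, hU, hinj⟩ := hl a
      filter_upwards [prod_mem_nhds hU hU] with p hp hpS
      exact hpS.2 (hinj hp.1 hp.2 hpS.1)
    · have hne : Φ a ≠ Φ b := fun h' => hab ⟨h', h⟩
      have : IsOpen {p : X × X | Φ p.1 ≠ Φ p.2} :=
        isOpen_ne_fun (hp.continuous.comp continuous_fst) (hp.continuous.comp continuous_snd)
      filter_upwards [this.mem_nhds hne] with p hp hpS
      exact hp hpS.1
  have hAc : IsClosed A := by
    have h1 : IsClosed (Prod.map Φ Φ '' S) := (hp.prodMap hp).isClosedMap _ hSc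
    convert h1.preimage (continuous_id.prodMk continuous_id : Continuous fun y : Y => (y, y)) using 1
    ext y
    simp only [hA, hS, mem_ofPred_eq, mem_preimage, mem_image, Prod.exists, Prod.map, Prod.mk.injEq,
      id_eq]
    exact ⟨fun ⟨a, b, hne, ha, hb⟩ => ⟨a, b, ⟨ha.trans hb.symm, hne⟩, ha, hb⟩,
      fun ⟨a, b, ⟨_, hne⟩, ha, hb⟩ => ⟨a, b, hne, ha, hb⟩⟩
  rcases isClopen_iff.1 ⟨hAc, hAo⟩ with h | h
  · intro a b hab
    by_contra hne
    have : Φ a ∈ A := ⟨a, b, hne, rfl, hab.symm⟩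
    rw [h] at this
    exact this
  · obtain ⟨a, b, hne, ha, hb⟩ : y₀ ∈ A := h ▸ mem_univ y₀
    exact absurd (hy₀ a b ha hb) hne

/-- A perturbation of the identity which is a local diffeomorphism is bijective, if the
perturbation is bounded and its derivative tends to zero at infinity. -/
theorem bijective_id_add [FiniteDimensional ℝ E] {φ : E → E} (hφ : ContDiff ℝ 1 φ) {K : ℝ}
    (hK : ∀ x, ‖φ x‖ ≤ K) (hφ' : Tendsto (fderiv ℝ φ) (cocompact E) (𝓝 0))
    (A : E → E ≃L[ℝ] E)
    (hA : ∀ x, (A x : E →L[ℝ] E) = ContinuousLinearMap.id ℝ E + fderiv ℝ φ x) :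
    IsOpenMap (fun x => x + φ x) ∧ Function.Bijective (fun x => x + φ x) := by
  have : ProperSpace E := FiniteDimensional.proper ℝ E
  have : CompleteSpace E := FiniteDimensional.complete ℝ E
  have hs : ∀ x, HasStrictFDerivAt (fun x => x + φ x) (A x : E →L[ℝ] E) x := by
    intro x
    rw [hA]
    exact (hasStrictFDerivAt_id x).add (hφ.contDiffAt.hasStrictFDerivAt one_ne_zero)
  have ho : IsOpenMap (fun x => x + φ x) := isOpenMap_iff_nhds_le.2 fun x =>
    (hs x).map_nhds_eq_of_equiv.ge
  have hp : IsProperMap (fun x => x + φ x) := isProperMap_iff_tendsto_cocompact.2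
    ⟨continuous_id.add hφ.continuous, tendsto_id_add_cocompact hK⟩
  have hl : ∀ x, ∃ U ∈ 𝓝 x, InjOn (fun x => x + φ x) U := fun x =>
    ⟨_, ((hs x).toOpenPartialHomeomorph _).open_source.mem_nhds
      (hs x).mem_toOpenPartialHomeomorph_source, ((hs x).toOpenPartialHomeomorph _).injOn⟩
  refine ⟨ho, ?_, ?_⟩
  · rcases subsingleton_or_nontrivial E with h | h
    · exact Function.injective_of_subsingleton _
    have hev : ∀ᶠ x in cocompact E, ‖fderiv ℝ φ x‖ ≤ 1 / 2 := by
      have := hφ'.norm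
      rw [norm_zero] at this
      exact this.eventually_le_const (by norm_num)
    rw [← Metric.cobounded_eq_cocompact, ← comap_norm_atTop, eventually_comap] at hev
    obtain ⟨R, hR⟩ := eventually_atTop.1 hev
    obtain ⟨y₀, hy₀⟩ := NormedSpace.exists_lt_norm ℝ E (R + K)
    refine injective_of_isProperMap hp ho hl (y₀ := y₀) fun a b ha hb => ?_
    have hmem : ∀ z, z + φ z = y₀ → z ∈ Metric.closedBall y₀ K := by
      intro z hz
      rw [Metric.mem_closedBall, dist_eq_norm, ← hz, sub_add_cancel_left, norm_neg]
      exact hK z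
    have hderiv : ∀ z ∈ Metric.closedBall y₀ K, ‖fderiv ℝ φ z‖ ≤ 1 / 2 := by
      intro z hz
      refine hR ‖z‖ ?_ z rfl
      rw [mem_closedBall_iff_norm'] at hz
      linarith [norm_sub_norm_le y₀ z]
    have hlip := (convex_closedBall y₀ K).norm_image_sub_le_of_norm_fderiv_le (𝕜 := ℝ)
      (fun z _ => hφ.differentiable one_ne_zero z) hderiv (hmem a ha) (hmem b hb)
    have heq : φ b - φ a = -(b - a) := by
      have : a + φ a = b + φ b := ha.trans hb.symm
      rw [neg_sub, sub_eq_sub_iff_add_eq_add, add_comm, ← this, add_comm]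
    rw [heq, norm_neg] at hlip
    have : ‖b - a‖ ≤ 0 := by linarith
    exact (sub_eq_zero.1 (norm_le_zero_iff.1 this)).symm
  · rw [← range_eq_univ]
    exact IsClopen.eq_univ ⟨hp.isClosedMap.isClosed_range, ho.isOpen_range⟩ (range_nonempty _)

omit [NormedSpace ℝ F] in
theorem exists_norm_le_of_tendsto_cocompact {X : Type*} [TopologicalSpace X] {g : X → F}
    (hg : Continuous g) {c : F} (hc : Tendsto g (cocompact X) (𝓝 c)) :
    ∃ M : ℝ, 0 ≤ M ∧ ∀ x, ‖g x‖ ≤ M := by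
  have hev : ∀ᶠ x in cocompact X, ‖g x‖ ≤ ‖c‖ + 1 := hc.norm.eventually_le_const (by linarith)
  obtain ⟨S, hS, hSc⟩ := mem_cocompact.1 hev
  obtain ⟨C, hC⟩ := hS.exists_bound_of_continuousOn hg.continuousOn
  refine ⟨max C (‖c‖ + 1), le_max_of_le_right (by positivity), fun x => ?_⟩
  by_cases hx : x ∈ S
  · exact (hC x hx).trans (le_max_left _ _)
  · exact (hSc hx : ‖g x‖ ≤ ‖c‖ + 1).trans (le_max_right _ _)

theorem exists_norm_le_mul_norm_apply [CompleteSpace E] {T : E → E →L[ℝ] E}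
    (hT : Continuous T) (hT0 : Tendsto T (cocompact E) (𝓝 0)) (A : E → E ≃L[ℝ] E)
    (hA : ∀ x, (A x : E →L[ℝ] E) = ContinuousLinearMap.id ℝ E + T x) :
    ∃ M : ℝ, 0 ≤ M ∧ ∀ x v, ‖v‖ ≤ M * ‖A x v‖ := by
  have hu : ∀ x, ContinuousLinearMap.inverse (ContinuousLinearMap.id ℝ E + T x) =
      ((A x).symm : E →L[ℝ] E) := fun x => by
    rw [← hA, ContinuousLinearMap.inverse_equiv]
  have hca : ∀ B : E ≃L[ℝ] E, ContinuousAt (ContinuousLinearMap.inverse : (E →L[ℝ] E) → E →L[ℝ] E)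
      (B : E →L[ℝ] E) := fun B =>
    (contDiffAt_map_inverse (n := 0) (𝕜 := ℝ) B).continuousAt
  have hcont : Continuous fun x => ((A x).symm : E →L[ℝ] E) := by
    simp only [← hu]
    rw [continuous_iff_continuousAt]
    intro x
    refine ContinuousAt.comp' (f := fun x => ContinuousLinearMap.id ℝ E + T x) ?_
      (continuous_const.add hT).continuousAt
    rw [← hA]
    exact hca (A x)
  have htend : Tendsto (fun x => ((A x).symm : E →L[ℝ] E)) (cocompact E)
      (𝓝 (ContinuousLinearMap.inverse (ContinuousLinearMap.id ℝ E))) := by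
    simp only [← hu]
    refine (hca (ContinuousLinearEquiv.refl ℝ E)).tendsto.comp ?_
    simpa using (tendsto_const_nhds (x := ContinuousLinearMap.id ℝ E)).add hT0
  obtain ⟨M, hM0, hM⟩ := exists_norm_le_of_tendsto_cocompact hcont htend
  refine ⟨M, hM0, fun x v => ?_⟩
  have := ((A x).symm : E →L[ℝ] E).le_of_opNorm_le (hM x) (A x v)
  simpa using this

namespace UniformHolder

theorem contDiff_one (hα0 : 0 < α) {f : ι → E → F} (hf : UniformHolder α (n + 1) f) (i : ι) :
    ContDiff ℝ 1 (f i) := by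
  refine (((uniformHolder_iff_iteratedFDeriv hα0).1 hf).1 i).of_le ?_
  exact_mod_cast Nat.le_add_left 1 n

theorem lipschitz_id_add {ψ : ι → E → E} (hψ : UniformHolder α (n + 1) ψ) :
    ∃ L : ℝ, ∀ i x y, ‖(x + ψ i x) - (y + ψ i y)‖ ≤ L * ‖x - y‖ := by
  obtain ⟨L, -, hL⟩ := hψ.lipschitz
  refine ⟨1 + L, fun i x y => ?_⟩
  rw [add_sub_add_comm, add_mul, one_mul]
  exact (norm_add_le _ _).trans (by gcongr; exact hL i x y)

theorem hasFDerivAt_invFun_id_add [FiniteDimensional ℝ E] (hα0 : 0 < α) {φ : ι → E → E}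
    (hφ : UniformHolder α (n + 1) φ) (hdec : ∀ i, DecaysToOrder (n + 1) (φ i))
    (A : ι → E → E ≃L[ℝ] E)
    (hA : ∀ i x, (A i x : E →L[ℝ] E) = ContinuousLinearMap.id ℝ E + _root_.fderiv ℝ (φ i) x)
    (i : ι) :
    Function.Bijective (fun x => x + φ i x) ∧ ∀ y,
      HasFDerivAt (Function.invFun fun x => x + φ i x)
        ((A i (Function.invFun (fun x => x + φ i x) y)).symm : E →L[ℝ] E) y := by
  obtain ⟨K, -, hK⟩ := hφ.bounded
  obtain ⟨ho, hb⟩ := bijective_id_add (hφ.contDiff_one hα0 i) (hK i) (hdec i).2.tendsto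
    (A i) (hA i)
  refine ⟨hb, fun y => ?_⟩
  have hr := Function.rightInverse_invFun hb.2
  have hl := Function.leftInverse_invFun hb.1
  have hc : Continuous (Function.invFun fun x => x + φ i x) := by
    refine continuous_def.2 fun s hs => ?_
    rw [← image_eq_preimage_of_inverse hl hr]
    exact ho s hs
  refine HasFDerivAt.of_local_left_inverse (f := fun x => x + φ i x) hc.continuousAt ?_
    (Eventually.of_forall fun z => hr z)
  rw [hA]
  exact (hasFDerivAt_id _).add (hφ.differentiable i _).hasFDerivAt

/-- Inverses of a family of diffeomorphisms `x ↦ x + φ i x` are uniformly bounded if the `φ i`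
and the inverses of the derivatives are. -/
theorem invFun_id_add [FiniteDimensional ℝ E] (hα0 : 0 < α) (hα1 : α ≤ 1) {φ : ι → E → E}
    (hφ : UniformHolder α (n + 1) φ) (hdec : ∀ i, DecaysToOrder (n + 1) (φ i))
    (A : ι → E → E ≃L[ℝ] E)
    (hA : ∀ i x, (A i x : E →L[ℝ] E) = ContinuousLinearMap.id ℝ E + _root_.fderiv ℝ (φ i) x)
    {M : ℝ} (hM0 : 0 ≤ M) (hM : ∀ i x v, ‖v‖ ≤ M * ‖A i x v‖) :
    UniformHolder α (n + 1) (fun i y => Function.invFun (fun x => x + φ i x) y - y) := by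
  have : CompleteSpace E := FiniteDimensional.complete ℝ E
  set Θ : ι → E → E := fun i => Function.invFun (fun x => x + φ i x) with hΘ
  have hmain := hasFDerivAt_invFun_id_add hα0 hφ hdec A hA
  have hΘd : ∀ i y, HasFDerivAt (Θ i) ((A i (Θ i y)).symm : E →L[ℝ] E) y := fun i => (hmain i).2
  have hsymm : ∀ i x, ‖((A i x).symm : E →L[ℝ] E)‖ ≤ M := fun i x =>
    ContinuousLinearMap.opNorm_le_bound _ hM0 fun v => by simpa using hM i x ((A i x).symm v)
  have hlip : ∀ i x y, ‖(x + (Θ i x - x)) - (y + (Θ i y - y))‖ ≤ M * ‖x - y‖ := by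
    intro i x y
    rw [add_sub_cancel, add_sub_cancel]
    exact convex_univ.norm_image_sub_le_of_norm_hasFDerivWithin_le (𝕜 := ℝ)
      (fun z _ => (hΘd i z).hasFDerivWithinAt) (fun z _ => hsymm i _) (mem_univ y) (mem_univ x)
  obtain ⟨K, -, hK⟩ := hφ.bounded
  have hbd : ∀ i y, ‖Θ i y - y‖ ≤ K := by
    intro i y
    have h : Θ i y + φ i (Θ i y) = y := Function.rightInverse_invFun (hmain i).1.2 y
    rw [sub_eq_iff_eq_add.2 (by rw [neg_add_eq_sub, eq_sub_iff_add_eq, h] :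
      Θ i y = -φ i (Θ i y) + y), norm_neg]
    exact hK i _
  have hd : ∀ i y, HasFDerivAt (fun y => Θ i y - y)
      (((A i (y + (Θ i y - y))).symm : E →L[ℝ] E) - ContinuousLinearMap.id ℝ E) y := by
    intro i y
    rw [add_sub_cancel]
    exact (hΘd i y).sub (hasFDerivAt_id y)
  have hstep : ∀ k ≤ n + 1, UniformHolder α k φ → UniformHolder α k (fun i y => Θ i y - y) := by
    intro k
    induction k with
    | zero =>
      intro _ _
      refine zero_of_lipschitz hα0 hα1 (L := M + 1) hbd fun i x y => ?_
      have := hlip i x y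
      rw [add_sub_cancel, add_sub_cancel] at this
      rw [sub_sub_sub_comm, add_mul, one_mul]
      exact (norm_sub_le _ _).trans (by gcongr)
    | succ k ih =>
      intro hk hφk
      refine ⟨⟨K, hbd⟩, fun i y => (hd i y).differentiableAt, ?_⟩
      have hfg : (fun i => _root_.fderiv ℝ (fun y => Θ i y - y)) =
          fun i y => ((A i (y + (Θ i y - y))).symm : E →L[ℝ] E) - ContinuousLinearMap.id ℝ E := by
        ext1 i
        ext1 y
        exact (hd i y).fderiv
      rw [hfg]
      have hAk : UniformHolder α k (fun i x => (A i x : E →L[ℝ] E)) := by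
        simp only [hA]
        exact (const _).add hφk.fderiv
      have hIk : UniformHolder α k (fun i x => ((A i x).symm : E →L[ℝ] E)) :=
        ringInverse hα0 hα1 (fun i x => (A i x).coe_comp_coe_symm)
          (fun i x => (A i x).coe_symm_comp_coe) ⟨M, hsymm⟩ hAk
      exact (hIk.comp_id_add hα0 hα1 hlip
        (ih (by omega) (hφk.of_succ hα0 hα1))).sub hα0 hα1 (const _)
  exact hstep (n + 1) le_rfl hφ

end UniformHolder

end UniformHolder

section MemD

variable {d n : ℕ} {β : ℝ}

theorem memD_id_add_iff (hβ0 : 0 < β) {φ : Euc d → Euc d} :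
    MemD d (n + 1) β (fun x => x + φ x) ↔
      UniformHolder β (n + 1) (fun _ : Unit => φ) ∧ DecaysToOrder (n + 1) φ ∧
        ∀ x, 0 < (ContinuousLinearMap.id ℝ (Euc d) + fderiv ℝ φ x).det := by
  rw [MemD, memC0_iff hβ0]
  simp only [add_sub_cancel_left, and_assoc]
  refine and_congr_right fun hu => and_congr_right fun _ => forall_congr' fun x => ?_
  have h := ((hasFDerivAt_id x).add (hu.differentiable () x).hasFDerivAt).fderiv
  exact iff_of_eq (congrArg (fun T : Euc d →L[ℝ] Euc d => 0 < T.det) h)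

theorem exists_equiv_of_det_pos {T : Euc d → Euc d →L[ℝ] Euc d} (hT : ∀ x, 0 < (T x).det) :
    ∃ A : Euc d → Euc d ≃L[ℝ] Euc d, ∀ x, (A x : Euc d →L[ℝ] Euc d) = T x :=
  ⟨fun x => (T x).toContinuousLinearEquivOfDetNeZero (hT x).ne',
    fun x => (T x).coe_toContinuousLinearEquivOfDetNeZero _⟩

theorem det_symm_pos (A : Euc d ≃L[ℝ] Euc d) (hA : 0 < (A : Euc d →L[ℝ] Euc d).det) :
    0 < (A.symm : Euc d →L[ℝ] Euc d).det := by
  have h : (A.symm : Euc d →L[ℝ] Euc d).det * (A : Euc d →L[ℝ] Euc d).det = 1 := by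
    rw [ContinuousLinearMap.det, ContinuousLinearMap.det, ← LinearMap.det_comp,
      ← ContinuousLinearMap.toLinearMap_comp, A.coe_symm_comp_coe]
    simp
  exact pos_of_mul_pos_left (h ▸ one_pos) hA.le

theorem memD_comp (hβ0 : 0 < β) (hβ1 : β ≤ 1) {Φ Ψ : Euc d → Euc d}
    (hΦ : MemD d (n + 1) β Φ) (hΨ : MemD d (n + 1) β Ψ) : MemD d (n + 1) β (Φ ∘ Ψ) := by
  obtain ⟨φ, rfl⟩ : ∃ φ : Euc d → Euc d, Φ = fun x => x + φ x := ⟨fun x => Φ x - x, by simp⟩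
  obtain ⟨ψ, rfl⟩ : ∃ ψ : Euc d → Euc d, Ψ = fun x => x + ψ x := ⟨fun x => Ψ x - x, by simp⟩
  have hcomp : (fun x => x + φ x) ∘ (fun x => x + ψ x) =
      fun x => x + (ψ x + φ (x + ψ x)) := by
    ext1 x
    simp [add_assoc]
  rw [hcomp]
  obtain ⟨hφu, hφd, hφ⟩ := (memD_id_add_iff hβ0).1 hΦ
  obtain ⟨hψu, hψd, hψ⟩ := (memD_id_add_iff hβ0).1 hΨ
  obtain ⟨L, hL⟩ := hψu.lipschitz_id_add
  obtain ⟨K, -, hK⟩ := hψu.bounded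
  have hu := hφu.comp_id_add hβ0 hβ1 hL hψu
  refine (memD_id_add_iff hβ0).2 ⟨hψu.add hu, hψd.add hψu hu
    (hφd.comp_id_add hβ0 hβ1 (hL ()) hφu hψu (tendsto_id_add_cocompact (hK ()))), fun x => ?_⟩
  have h1 := ((hasFDerivAt_id (x + ψ x)).add (hφu.differentiable () (x + ψ x)).hasFDerivAt).comp x
    ((hasFDerivAt_id x).add (hψu.differentiable () x).hasFDerivAt)
  have h2 := (hasFDerivAt_id x).add
    ((hψu.add hu).differentiable () x).hasFDerivAt
  have heq := h2.unique (h1.congr_of_eventuallyEq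
    (Eventually.of_forall fun y => (congrFun hcomp y).symm))
  rw [heq, ContinuousLinearMap.det, ContinuousLinearMap.toLinearMap_comp, LinearMap.det_comp]
  exact mul_pos (hφ _) (hψ _)

theorem exists_equiv_bound (hβ0 : 0 < β) {φ : Euc d → Euc d}
    (hφ : MemD d (n + 1) β (fun x => x + φ x)) :
    ∃ A : Euc d → Euc d ≃L[ℝ] Euc d,
      (∀ x, (A x : Euc d →L[ℝ] Euc d) = ContinuousLinearMap.id ℝ (Euc d) + fderiv ℝ φ x) ∧
      ∃ M : ℝ, 0 ≤ M ∧ ∀ x v, ‖v‖ ≤ M * ‖A x v‖ := by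
  obtain ⟨hφu, hφd, hφ⟩ := (memD_id_add_iff hβ0).1 hφ
  obtain ⟨A, hA⟩ := exists_equiv_of_det_pos hφ
  exact ⟨A, hA, exists_norm_le_mul_norm_apply
    ((hφu.contDiff_one hβ0 ()).continuous_fderiv one_ne_zero) hφd.2.tendsto A hA⟩

theorem memD_invFun (hβ0 : 0 < β) (hβ1 : β ≤ 1) {Φ : Euc d → Euc d}
    (hΦ : MemD d (n + 1) β Φ) : MemD d (n + 1) β (Function.invFun Φ) := by
  obtain ⟨φ, rfl⟩ : ∃ φ : Euc d → Euc d, Φ = fun x => x + φ x := ⟨fun x => Φ x - x, by simp⟩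
  obtain ⟨hφu, hφd, hφ⟩ := (memD_id_add_iff hβ0).1 hΦ
  obtain ⟨A, hA, M, hM0, hM⟩ := exists_equiv_bound hβ0 hΦ
  have hu := hφu.invFun_id_add hβ0 hβ1 (fun _ => hφd) (fun _ => A) (fun _ => hA) hM0
    (fun _ => hM)
  obtain ⟨hb, hd⟩ := hφu.hasFDerivAt_invFun_id_add hβ0 (fun _ => hφd) (fun _ => A)
    (fun _ => hA) ()
  set Θ := Function.invFun (fun x => x + φ x) with hΘ
  have hr : ∀ y, Θ y + φ (Θ y) = y := Function.rightInverse_invFun hb.2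
  have hfix : (fun y => Θ y - y) = fun y => -φ (y + (Θ y - y)) := by
    ext1 y
    rw [add_sub_cancel, ← add_eq_zero_iff_eq_neg, sub_add_eq_add_sub, hr, sub_self]
  obtain ⟨L, hL⟩ := hu.lipschitz_id_add
  obtain ⟨K, -, hK⟩ := hu.bounded
  refine ⟨(memC0_iff hβ0).2 ⟨hu, ?_⟩, fun y => ?_⟩
  · rw [hfix]
    exact (hφd.comp_id_add hβ0 hβ1 (hL ()) hφu hu (tendsto_id_add_cocompact (hK ()))).neg
  · rw [(hd y).fderiv]
    refine det_symm_pos (A (Θ y)) ?_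
    rw [hA]
    exact hφ _

theorem eHnorm_le_toNNReal {f : Euc d → Euc d} {δ : ℝ} (hf : MemCb n β f) (h : hnorm n β f ≤ δ) :
    eHnorm n β f ≤ δ.toNNReal :=
  (ENNReal.ofReal_toReal hf.2.ne).symm.le.trans (ENNReal.ofReal_le_ofReal h)

theorem exists_hnorm_invFun_le (hβ0 : 0 < β) (hβ1 : β ≤ 1) {φ₀ : Euc d → Euc d}
    (hφ₀ : MemD d (n + 1) β (fun x => x + φ₀ x)) :
    ∃ δ > (0 : ℝ), ∃ C : ℝ, ∀ φ : Euc d → Euc d, MemD d (n + 1) β (fun x => x + φ x) →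
      hnorm (n + 1) β (φ - φ₀) < δ →
      hnorm (n + 1) β (fun x => Function.invFun (fun y => y + φ y) x - x) ≤ C := by
  obtain ⟨A₀, hA₀, M, hM0, hM⟩ := exists_equiv_bound hβ0 hφ₀
  obtain ⟨hφ₀u, -, -⟩ := (memD_id_add_iff hβ0).1 hφ₀
  set δ : ℝ := 1 / (2 * (M + 1)) with hδ
  have hδ0 : 0 < δ := by positivity
  have hMδ : M * δ ≤ 1 / 2 := by
    rw [hδ, mul_one_div, div_le_div_iff₀ (by positivity) (by norm_num)]
    linarith
  refine ⟨δ, hδ0, ?_⟩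
  let ι := {φ : Euc d → Euc d //
    MemD d (n + 1) β (fun x => x + φ x) ∧ hnorm (n + 1) β (φ - φ₀) < δ}
  have hmem : ∀ i : ι, UniformHolder β (n + 1) (fun _ : Unit => i.1) ∧
      DecaysToOrder (n + 1) i.1 ∧
        ∀ x, 0 < (ContinuousLinearMap.id ℝ (Euc d) + fderiv ℝ i.1 x).det :=
    fun i => (memD_id_add_iff hβ0).1 i.2.1
  have hdiff : ∀ i : ι, MemCb (n + 1) β (i.1 - φ₀) := fun i =>
    (memCb_iff_uniformHolder hβ0).2 ((hmem i).1.sub hβ0 hβ1 hφ₀u)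
  have hle : ∀ i : ι, eHnorm (n + 1) β (i.1 - φ₀) ≤ δ.toNNReal := fun i =>
    eHnorm_le_toNNReal (hdiff i) i.2.2.le
  have hudiff : UniformHolder β (n + 1) (fun i : ι => i.1 - φ₀) :=
    (uniformHolder_iff_eHnorm hβ0).2 ⟨fun i => (hdiff i).1, _, hle⟩
  have hu : UniformHolder β (n + 1) (fun i : ι => i.1) := by
    have := hudiff.add (hφ₀u.reindex fun _ : ι => ())
    simpa using this
  choose A hA using fun i : ι => exists_equiv_of_det_pos (hmem i).2.2
  have hAM : ∀ i x v, ‖v‖ ≤ (2 * M) * ‖A i x v‖ := by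
    intro i x v
    have hfd : ‖fderiv ℝ (i.1 - φ₀) x‖ ≤ δ := by
      have := eCnb_le_iff.1 ((le_max_left _ _).trans (hle i)) 1 (by omega) x
      rwa [norm_iteratedFDeriv_one, Real.coe_toNNReal _ hδ0.le] at this
    have hsub : A i x v = A₀ x v + fderiv ℝ (i.1 - φ₀) x v := by
      have h1 := DFunLike.congr_fun (hA i x) v
      have h2 := DFunLike.congr_fun (hA₀ x) v
      rw [fderiv_sub ((hmem i).1.differentiable () x) (hφ₀u.differentiable () x)]
      simp only [ContinuousLinearEquiv.coe_coe, add_apply] at h1 h2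
      rw [h1, h2, sub_apply]
      abel
    have h3 : ‖A₀ x v‖ ≤ ‖A i x v‖ + δ * ‖v‖ := by
      rw [← sub_eq_iff_eq_add.2 hsub]
      exact (norm_sub_le _ _).trans (by gcongr; exact ContinuousLinearMap.le_of_opNorm_le _ hfd v)
    have h4 := (hM x v).trans (mul_le_mul_of_nonneg_left h3 hM0)
    have h5 := mul_le_mul_of_nonneg_right hMδ (norm_nonneg v)
    linarith
  have hinv := hu.invFun_id_add hβ0 hβ1 (fun i => (hmem i).2.1) A hA (by positivity) hAM
  obtain ⟨-, C, hC⟩ := (uniformHolder_iff_eHnorm hβ0).1 hinv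
  exact ⟨C, fun φ hφ hφδ => hnorm_le_of_eHnorm_le (hC ⟨φ, hφ, hφδ⟩)⟩

end MemD

/-- `D^{n,β}(ℝ^d)` is a group under composition (closed under
composition and inversion), and the chart representation of inversion
`inv_c : φ ↦ (Id+φ)⁻¹ − Id` is locally bounded on `D^{n,β}(ℝ^d) − Id`. -/
theorem stmt9 (d n : ℕ) (hn : 1 ≤ n) (β : ℝ) (hβ0 : 0 < β) (hβ1 : β ≤ 1) :
    (∀ Φ Ψ : Euc d → Euc d, MemD d n β Φ → MemD d n β Ψ → MemD d n β (Φ ∘ Ψ)) ∧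
    (∀ Φ : Euc d → Euc d, MemD d n β Φ → MemD d n β (Function.invFun Φ)) ∧
    (∀ φ₀ : Euc d → Euc d, MemD d n β (fun x => x + φ₀ x) →
      ∃ δ > (0 : ℝ), ∃ C : ℝ, ∀ φ : Euc d → Euc d, MemD d n β (fun x => x + φ x) →
        hnorm n β (φ - φ₀) < δ →
        hnorm n β (fun x => Function.invFun (fun y => y + φ y) x - x) ≤ C) := by
  obtain ⟨n, rfl⟩ := Nat.exists_eq_add_of_le' hn
  exact ⟨fun Φ Ψ hΦ hΨ => memD_comp hβ0 hβ1 hΦ hΨ, fun Φ hΦ => memD_invFun hβ0 hβ1 hΦ,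
    fun φ₀ hφ₀ => exists_hnorm_invFun_le hβ0 hβ1 hφ₀⟩
end

section
/- Let n ∈ ℕ with n ≥ 1 and β ∈ (0,1]. Let χ ∈ C_c^∞(ℝ) with χ ≡ 1 on [−1,1], and set ψ(x) := xⁿ|x|^β χ(x), so that ψ ∈ C^{n,β}_0(ℝ,ℝ); set Φ_k(x) := x + χ(x)/k. Then Φ_k → Id in the ‖·‖_{n,β}-norm as k → ∞, Φ_k ∈ D^{n,β}(ℝ) for all sufficiently large k, and yet ‖ψ∘Φ_k − ψ‖_{n,β} ≥ 2(1+β)(2+β)⋯(n+β) for all sufficiently large k. Consequently, the left translation f ↦ ψ∘f on D^{n,β}(ℝ) is discontinuous at Id. -/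
open Function Set Filter Topology MeasureTheory
open scoped ENNReal NNReal

/-- Membership in `D^{n,β}(ℝ)` (the one-dimensional case):
`Φ - Id ∈ C^{n,β}_0(ℝ,ℝ)` and `Φ'(x) > 0` everywhere. -/
def MemD1 (n : ℕ) (β : ℝ) (Φ : ℝ → ℝ) : Prop :=
  MemC0 n β (fun x => Φ x - x) ∧ ∀ x, 0 < deriv Φ x

/-- `ψ(x) = xⁿ |x|^β χ(x)` -/
noncomputable def psiW (n : ℕ) (β : ℝ) (χ : ℝ → ℝ) : ℝ → ℝ :=
  fun x => x ^ n * |x| ^ β * χ x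

/-- The function `g` satisfies a Hölder estimate of exponent `β` near `x`. -/
def HolderNear (β : ℝ) (g : ℝ → ℝ) (x : ℝ) : Prop :=
  ∃ C : ℝ, ∀ᶠ p : ℝ × ℝ in 𝓝 (x, x), |g p.1 - g p.2| ≤ C * |p.1 - p.2| ^ β

lemma HolderNear.congr {β : ℝ} {f g : ℝ → ℝ} {x : ℝ} (hf : HolderNear β f x)
    (h : f =ᶠ[𝓝 x] g) : HolderNear β g x := by
  obtain ⟨C, hC⟩ := hf
  refine ⟨C, ?_⟩
  rw [nhds_prod_eq] at hC ⊢
  filter_upwards [hC, h.prod_inl (𝓝 x), h.prod_inr (𝓝 x)] with p hp h1 h2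
  simpa [← h1, ← h2] using hp

lemma HolderNear.sub {β : ℝ} {f g : ℝ → ℝ} {x : ℝ} (hf : HolderNear β f x)
    (hg : HolderNear β g x) : HolderNear β (fun y => f y - g y) x := by
  obtain ⟨C, hC⟩ := hf
  obtain ⟨D, hD⟩ := hg
  refine ⟨C + D, ?_⟩
  filter_upwards [hC, hD] with p h1 h2
  calc |f p.1 - g p.1 - (f p.2 - g p.2)| = |(f p.1 - f p.2) - (g p.1 - g p.2)| := by ring_nf
    _ ≤ |f p.1 - f p.2| + |g p.1 - g p.2| := abs_sub _ _
    _ ≤ _ := by rw [add_mul]; exact add_le_add h1 h2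

lemma HolderNear.of_contDiffAt {β : ℝ} (hβ1 : β ≤ 1) {g : ℝ → ℝ} {x : ℝ}
    (hg : ContDiffAt ℝ 1 g x) : HolderNear β g x := by
  obtain ⟨K, t, ht, hK⟩ := hg.exists_lipschitzOnWith
  refine ⟨K, ?_⟩
  have hball : ∀ᶠ p : ℝ × ℝ in 𝓝 (x, x), |p.1 - p.2| < 1 := by
    have hc : Continuous fun p : ℝ × ℝ => |p.1 - p.2| := by fun_prop
    exact hc.continuousAt.eventually_lt continuousAt_const (by simp)
  filter_upwards [prod_mem_nhds ht ht, hball] with p hp hp1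
  have h := hK.dist_le_mul p.1 hp.1 p.2 hp.2
  rw [Real.dist_eq, Real.dist_eq] at h
  refine h.trans (mul_le_mul_of_nonneg_left ?_ K.2)
  rcases (abs_nonneg (p.1 - p.2)).eq_or_lt with h0 | h0
  · rw [← h0]; positivity
  · simpa using Real.rpow_le_rpow_of_exponent_ge h0 hp1.le hβ1

lemma contDiffAt_iteratedDeriv {f : ℝ → ℝ} {x : ℝ} (n : ℕ)
    (hf : ContDiffAt ℝ (⊤ : ℕ∞) f x) : ContDiffAt ℝ 1 (iteratedDeriv n f) x := by
  rw [iteratedDeriv_eq_equiv_comp]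
  have h1 : ContDiffAt ℝ 1 (iteratedFDeriv ℝ n f) x :=
    hf.iteratedFDeriv_right (by exact_mod_cast le_top)
  exact (ContinuousMultilinearMap.piFieldEquiv ℝ (Fin n) ℝ).symm.contDiff.contDiffAt.comp x h1

lemma hasCompactSupport_iteratedDeriv {f : ℝ → ℝ} (hf : HasCompactSupport f) (n : ℕ) :
    HasCompactSupport (iteratedDeriv n f) := by
  rw [iteratedDeriv_eq_equiv_comp]
  exact (hf.iteratedFDeriv n).comp_left (map_zero _)

/-- A compactly supported continuous function that is locally Hölder is globally Hölder. -/
lemma exists_holder_bound {β : ℝ} (hβ0 : 0 < β) {g : ℝ → ℝ} (hg : Continuous g)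
    (hgc : HasCompactSupport g) (hloc : ∀ x, HolderNear β g x) :
    ∃ C : ℝ, ∀ x y, |g x - g y| ≤ C * |x - y| ^ β := by
  obtain ⟨M, hM⟩ := hgc.exists_bound_of_continuous hg
  obtain ⟨R, hR⟩ := hgc.isCompact.isBounded.subset_closedBall 0
  set r : ℝ := max R 0 + 1
  have hr : -r ≤ r := by
    have := le_max_right R 0
    linarith
  have hzero : ∀ x, r ≤ |x| → g x = 0 := fun x hx => by
    by_contra h
    have h1 := hR (subset_tsupport g h)
    rw [Metric.mem_closedBall, dist_zero_right, Real.norm_eq_abs] at h1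
    have := le_max_left R 0
    linarith
  have hcomp : IsCompact (Icc (-r) r ×ˢ Icc (-r) r) := isCompact_Icc.prod isCompact_Icc
  obtain ⟨C, hC⟩ : ∃ C : ℝ, 0 ≤ C ∧ ∀ p ∈ Icc (-r) r ×ˢ Icc (-r) r,
      |g p.1 - g p.2| ≤ C * |p.1 - p.2| ^ β := by
    refine hcomp.induction_on (p := fun S : Set (ℝ × ℝ) => ∃ C : ℝ, 0 ≤ C ∧ ∀ p ∈ S,
      |g p.1 - g p.2| ≤ C * |p.1 - p.2| ^ β) ⟨0, le_rfl, by simp⟩ ?_ ?_ ?_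
    · rintro s t hst ⟨C, hC0, hC⟩
      exact ⟨C, hC0, fun p hp => hC p (hst hp)⟩
    · rintro s t ⟨C, hC0, hC⟩ ⟨D, hD0, hD⟩
      refine ⟨C + D, add_nonneg hC0 hD0, ?_⟩
      have hnn : ∀ p : ℝ × ℝ, 0 ≤ |p.1 - p.2| ^ β := fun p => by positivity
      rintro p (hp | hp)
      · nlinarith [hC p hp, mul_nonneg hD0 (hnn p)]
      · nlinarith [hD p hp, mul_nonneg hC0 (hnn p)]
    · rintro ⟨a, b⟩ -
      by_cases hab : a = b
      · subst hab
        obtain ⟨C, hC⟩ := hloc a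
        refine ⟨_, mem_nhdsWithin_of_mem_nhds hC, |C|, abs_nonneg C, fun p hp => ?_⟩
        exact le_trans hp (mul_le_mul_of_nonneg_right (le_abs_self C) (by positivity))
      · have hd : 0 < |a - b| := abs_pos.2 (sub_ne_zero.2 hab)
        have hc : Continuous fun p : ℝ × ℝ => |p.1 - p.2| := by fun_prop
        have hev : ∀ᶠ p : ℝ × ℝ in 𝓝 (a, b), |a - b| / 2 < |p.1 - p.2| :=
          continuousAt_const.eventually_lt hc.continuousAt (by simpa using hd)
        have hM0 : 0 ≤ M := (norm_nonneg _).trans (hM 0)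
        have hd' : 0 < (|a - b| / 2) ^ β := by positivity
        refine ⟨_, mem_nhdsWithin_of_mem_nhds hev, 2 * M / (|a - b| / 2) ^ β, by positivity,
          fun p hp => ?_⟩
        calc |g p.1 - g p.2| ≤ |g p.1| + |g p.2| := abs_sub _ _
          _ ≤ 2 * M := by
            have h1 := hM p.1
            have h2 := hM p.2
            rw [Real.norm_eq_abs] at h1 h2
            linarith
          _ = 2 * M / (|a - b| / 2) ^ β * (|a - b| / 2) ^ β := by field_simp
          _ ≤ _ := by
            refine mul_le_mul_of_nonneg_left ?_ (by positivity)
            exact Real.rpow_le_rpow (by positivity) (le_of_lt hp) hβ0.le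
  have hproj : ∀ x, g (projIcc (-r) r hr x) = g x := fun x => by
    have hr0 : 0 < r := by positivity
    rcases le_total x (-r) with h | h
    · rw [projIcc_of_le_left hr h, hzero x (by rw [abs_of_nonpos (by linarith)]; linarith)]
      exact hzero _ (by simp [abs_of_pos hr0])
    · rcases le_total r x with h' | h'
      · rw [projIcc_of_right_le hr h', hzero x (h'.trans (le_abs_self x))]
        exact hzero _ (by simp [abs_of_pos hr0])
      · rw [projIcc_of_mem hr ⟨h, h'⟩]
  refine ⟨C, fun x y => ?_⟩
  rw [← hproj x, ← hproj y]
  refine (hC.2 (_, _) ⟨(projIcc (-r) r hr x).2, (projIcc (-r) r hr y).2⟩).trans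
    (mul_le_mul_of_nonneg_left ?_ hC.1)
  exact Real.rpow_le_rpow (abs_nonneg _) (abs_projIcc_sub_projIcc hr) hβ0.le

lemma eHnorm_le_of_bounds {n : ℕ} {β M : ℝ} {f : ℝ → ℝ}
    (hb : ∀ l ≤ n, ∀ x, |iteratedDeriv l f x| ≤ M)
    (hh : ∀ x y, |iteratedDeriv n f x - iteratedDeriv n f y| ≤ M * |x - y| ^ β) :
    eHnorm n β f ≤ ENNReal.ofReal M := by
  refine max_le ?_ ?_
  · refine iSup₂_le fun l x => ?_
    rw [← enorm_eq_nnnorm, ← ofReal_norm, norm_iteratedFDeriv_eq_norm_iteratedDeriv]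
    exact ENNReal.ofReal_le_ofReal (hb l (Nat.lt_succ_iff.1 l.2) x)
  · refine iSup_le fun x => iSup₂_le fun y hxy => ?_
    have hd : 0 < |x - y| := abs_pos.2 (sub_ne_zero.2 hxy)
    rw [← enorm_eq_nnnorm, ← ofReal_norm, iteratedFDeriv_eq_equiv_comp, comp_apply, comp_apply,
      ← map_sub, LinearIsometryEquiv.norm_map, edist_dist, Real.dist_eq,
      ENNReal.ofReal_rpow_of_pos hd, ← ENNReal.ofReal_div_of_pos (by positivity)]
    refine ENNReal.ofReal_le_ofReal ?_
    rw [div_le_iff₀ (by positivity)]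
    exact hh x y

/-- Difference quotients of the top derivative are bounded by the Hölder norm. -/
lemma div_le_hnorm {n : ℕ} {β : ℝ} {f : ℝ → ℝ} (hf : eHnorm n β f < ⊤) {x y : ℝ}
    (hxy : x ≠ y) :
    |iteratedDeriv n f x - iteratedDeriv n f y| / |x - y| ^ β ≤ hnorm n β f := by
  have hd : 0 < |x - y| := abs_pos.2 (sub_ne_zero.2 hxy)
  refine (ENNReal.ofReal_le_iff_le_toReal hf.ne).1 ?_
  refine le_trans ?_ (le_max_right (eCnb n f) (eHsemi n β f))
  refine le_trans ?_ (le_iSup_of_le x (le_iSup₂_of_le y hxy le_rfl))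
  rw [← enorm_eq_nnnorm, ← ofReal_norm, iteratedFDeriv_eq_equiv_comp, comp_apply, comp_apply,
      ← map_sub, LinearIsometryEquiv.norm_map, edist_dist, Real.dist_eq,
      ENNReal.ofReal_rpow_of_pos hd, ← ENNReal.ofReal_div_of_pos (by positivity), Real.norm_eq_abs]

lemma exists_bounds {n : ℕ} {β : ℝ} (hβ0 : 0 < β) {f : ℝ → ℝ} (hf : ContDiff ℝ n f)
    (hc : HasCompactSupport f) (hloc : ∀ x, HolderNear β (iteratedDeriv n f) x) :
    ∃ M : ℝ, (∀ l ≤ n, ∀ x, |iteratedDeriv l f x| ≤ M) ∧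
      ∀ x y, |iteratedDeriv n f x - iteratedDeriv n f y| ≤ M * |x - y| ^ β := by
  have hcont : ∀ l ≤ n, Continuous (iteratedDeriv l f) := fun l hl =>
    hf.continuous_iteratedDeriv l (by exact_mod_cast hl)
  obtain ⟨C, hC⟩ := exists_holder_bound hβ0 (hcont n le_rfl)
    (hasCompactSupport_iteratedDeriv hc n) hloc
  have hex : ∀ l, ∃ B, l ≤ n → ∀ x, |iteratedDeriv l f x| ≤ B := fun l => by
    by_cases hl : l ≤ n
    · obtain ⟨B, hB⟩ := (hasCompactSupport_iteratedDeriv hc l).exists_bound_of_continuous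
        (hcont l hl)
      exact ⟨B, fun _ => hB⟩
    · exact ⟨0, fun h => absurd h hl⟩
  choose B hB using hex
  refine ⟨max C (∑ l ∈ Finset.range (n + 1), |B l|), fun l hl x => ?_, fun x y => ?_⟩
  · refine (hB l hl x).trans ((le_abs_self _).trans (le_max_of_le_right ?_))
    exact Finset.single_le_sum (f := fun l => |B l|) (fun _ _ => abs_nonneg _)
      (Finset.mem_range.2 (Nat.lt_succ_of_le hl))
  · exact (hC x y).trans (mul_le_mul_of_nonneg_right (le_max_left _ _) (by positivity))

lemma memC0_of_holderNear {n : ℕ} {β : ℝ} (hβ0 : 0 < β) {f : ℝ → ℝ} (hf : ContDiff ℝ n f)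
    (hc : HasCompactSupport f) (hloc : ∀ x, HolderNear β (iteratedDeriv n f) x) :
    MemC0 n β f := by
  obtain ⟨M, hM, hM'⟩ := exists_bounds hβ0 hf hc hloc
  refine ⟨⟨by exact_mod_cast hf,
    (eHnorm_le_of_bounds hM hM').trans_lt ENNReal.ofReal_lt_top⟩, fun l _ => ?_⟩
  refine tendsto_const_nhds.congr' ?_
  filter_upwards [(hc.iteratedFDeriv (𝕜 := ℝ) l).isCompact.compl_mem_cocompact] with x hx
  rw [image_eq_zero_of_notMem_tsupport hx, norm_zero]

lemma hasDerivAt_pow_mul_abs_rpow {β : ℝ} (hβ0 : 0 < β) (m : ℕ) (x : ℝ) :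
    HasDerivAt (fun y : ℝ => y ^ (m + 1) * |y| ^ β)
      ((m + 1 + β) * (x ^ m * |x| ^ β)) x := by
  rcases eq_or_ne x 0 with rfl | hx
  · have h0 : ((m + 1 + β) * ((0 : ℝ) ^ m * |(0 : ℝ)| ^ β)) = 0 := by
      simp [Real.zero_rpow hβ0.ne']
    rw [h0, hasDerivAt_iff_tendsto_slope]
    have hc : Continuous fun y : ℝ => y ^ m * |y| ^ β :=
      (continuous_pow m).mul (continuous_abs.rpow_const fun _ => Or.inr hβ0.le)
    have ht := hc.tendsto 0
    simp only [abs_zero, Real.zero_rpow hβ0.ne', mul_zero] at ht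
    refine (ht.mono_left nhdsWithin_le_nhds).congr' ?_
    filter_upwards [self_mem_nhdsWithin] with y hy
    have hy : y ≠ 0 := hy
    simp only [slope_def_field, abs_zero, Real.zero_rpow hβ0.ne', mul_zero, sub_zero]
    field_simp
    ring
  · have h1 := ((hasDerivAt_abs hx).rpow_const (p := β) (Or.inl (abs_ne_zero.2 hx)))
    refine ((hasDerivAt_pow (m + 1) x).mul h1).congr_deriv ?_
    have hpos : 0 < |x| := abs_pos.2 hx
    have h2 : |x| ^ (β - 1) * |x| = |x| ^ β := by
      rw [← Real.rpow_add_one hpos.ne', sub_add_cancel]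
    have h4 : x ^ (m + 1) * ((SignType.sign x : ℝ) * β * |x| ^ (β - 1)) =
        β * (x ^ m * |x| ^ β) := by
      have h5 : x * (SignType.sign x : ℝ) = |x| := by
        rw [mul_comm]; exact sign_mul_self x
      rw [← h2, ← h5]; ring
    rw [h4, Nat.add_sub_cancel]
    push_cast
    ring

lemma contDiff_pow_mul_abs_rpow {β : ℝ} (hβ0 : 0 < β) (n : ℕ) :
    ContDiff ℝ n (fun y : ℝ => y ^ n * |y| ^ β) := by
  induction n with
  | zero =>
    simp only [pow_zero, one_mul, Nat.cast_zero, contDiff_zero]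
    exact continuous_abs.rpow_const fun _ => Or.inr hβ0.le
  | succ n ih =>
    push_cast
    rw [contDiff_succ_iff_deriv]
    refine ⟨fun x => (hasDerivAt_pow_mul_abs_rpow hβ0 n x).differentiableAt, by simp, ?_⟩
    rw [funext fun x => (hasDerivAt_pow_mul_abs_rpow hβ0 n x).deriv]
    exact contDiff_const.mul ih

lemma iteratedDeriv_pow_mul_abs_rpow {β : ℝ} (hβ0 : 0 < β) (n : ℕ) (x : ℝ) :
    iteratedDeriv n (fun y : ℝ => y ^ n * |y| ^ β) x =
      (∏ j ∈ Finset.range n, ((j : ℝ) + 1 + β)) * |x| ^ β := by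
  induction n with
  | zero => simp
  | succ n ih =>
    rw [iteratedDeriv_succ', funext fun x => (hasDerivAt_pow_mul_abs_rpow hβ0 n x).deriv,
      iteratedDeriv_const_mul_field, ih, Finset.prod_range_succ]
    ring

lemma abs_abs_rpow_sub_le {β : ℝ} (hβ0 : 0 < β) (hβ1 : β ≤ 1) (y z : ℝ) :
    |(|y| ^ β - |z| ^ β)| ≤ |y - z| ^ β := by
  have key : ∀ a b : ℝ, |a| ^ β ≤ |b| ^ β + |a - b| ^ β := fun a b =>
    calc |a| ^ β ≤ (|b| + |a - b|) ^ β := by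
          refine Real.rpow_le_rpow (abs_nonneg a) ?_ hβ0.le
          simpa using abs_add_le b (a - b)
      _ ≤ _ := Real.rpow_add_le_add_rpow (abs_nonneg _) (abs_nonneg _) hβ0.le hβ1
  have h1 := key y z
  have h2 := key z y
  rw [abs_sub_comm z y] at h2
  exact abs_sub_le_iff.2 ⟨by linarith, by linarith⟩

lemma holderNear_iteratedDeriv_pow_mul_abs_rpow {β : ℝ} (hβ0 : 0 < β) (hβ1 : β ≤ 1) (n : ℕ)
    (a x : ℝ) :
    HolderNear β (iteratedDeriv n (fun y : ℝ => (y + a) ^ n * |y + a| ^ β)) x := by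
  have hP : 0 ≤ ∏ j ∈ Finset.range n, ((j : ℝ) + 1 + β) :=
    Finset.prod_nonneg fun j _ => by positivity
  refine ⟨∏ j ∈ Finset.range n, ((j : ℝ) + 1 + β), Eventually.of_forall fun p => ?_⟩
  rw [iteratedDeriv_comp_add_const n (fun y : ℝ => y ^ n * |y| ^ β) a]
  simp only [iteratedDeriv_pow_mul_abs_rpow hβ0]
  rw [← mul_sub, abs_mul, abs_of_nonneg hP]
  refine mul_le_mul_of_nonneg_left ?_ hP
  simpa using abs_abs_rpow_sub_le hβ0 hβ1 (p.1 + a) (p.2 + a)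

lemma psiW_contDiffAt_of_ne {n : ℕ} {β : ℝ} {χ : ℝ → ℝ} (hχ : ContDiff ℝ (⊤ : ℕ∞) χ) {x : ℝ}
    (hx : x ≠ 0) : ContDiffAt ℝ (⊤ : ℕ∞) (psiW n β χ) x := by
  have h : ContDiffAt ℝ (⊤ : ℕ∞) (fun y : ℝ => |y| ^ β) x :=
    (Real.contDiffAt_rpow_const_of_ne (abs_ne_zero.2 hx)).comp x (contDiffAt_abs hx)
  exact ((contDiff_id.pow n).contDiffAt.mul h).mul hχ.contDiffAt

lemma psiW_contDiff {n : ℕ} {β : ℝ} (hβ0 : 0 < β) {χ : ℝ → ℝ} (hχ : ContDiff ℝ (⊤ : ℕ∞) χ) :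
    ContDiff ℝ n (psiW n β χ) :=
  (contDiff_pow_mul_abs_rpow hβ0 n).mul (hχ.of_le (by exact_mod_cast le_top))

lemma eventually_eq_one {χ : ℝ → ℝ} (hχ1 : ∀ x ∈ Icc (-1 : ℝ) 1, χ x = 1) {x : ℝ}
    (hx : |x| < 1) : ∀ᶠ y in 𝓝 x, χ y = 1 := by
  filter_upwards [continuous_abs.continuousAt.eventually_lt continuousAt_const hx] with y hy
  exact hχ1 y (abs_le.1 (le_of_lt hy))

lemma psiW_eventuallyEq {n : ℕ} {β : ℝ} {χ : ℝ → ℝ} (hχ1 : ∀ x ∈ Icc (-1 : ℝ) 1, χ x = 1)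
    {x : ℝ} (hx : |x| < 1) : psiW n β χ =ᶠ[𝓝 x] fun y => y ^ n * |y| ^ β := by
  filter_upwards [eventually_eq_one hχ1 hx] with y hy
  simp [psiW, hy]

lemma psiW_comp_eventuallyEq {n : ℕ} {β : ℝ} {χ : ℝ → ℝ}
    (hχ1 : ∀ x ∈ Icc (-1 : ℝ) 1, χ x = 1) {x c : ℝ} (hx : |x| < 1) (hxc : |x + 1 / c| < 1) :
    (fun y => psiW n β χ (y + χ y / c)) =ᶠ[𝓝 x]
      fun y => (y + 1 / c) ^ n * |y + 1 / c| ^ β := by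
  have ht : Tendsto (fun y : ℝ => y + 1 / c) (𝓝 x) (𝓝 (x + 1 / c)) :=
    (continuous_id.add continuous_const).tendsto x
  filter_upwards [eventually_eq_one hχ1 hx, ht.eventually (psiW_eventuallyEq hχ1 hxc)]
    with y hy hy'
  rw [hy, hy']

lemma holderNear_iteratedDeriv_psiW {n : ℕ} {β : ℝ} (hβ0 : 0 < β) (hβ1 : β ≤ 1) {χ : ℝ → ℝ}
    (hχ : ContDiff ℝ (⊤ : ℕ∞) χ) (hχ1 : ∀ x ∈ Icc (-1 : ℝ) 1, χ x = 1) (x : ℝ) :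
    HolderNear β (iteratedDeriv n (psiW n β χ)) x := by
  rcases eq_or_ne x 0 with rfl | hx
  · have h := holderNear_iteratedDeriv_pow_mul_abs_rpow hβ0 hβ1 n 0 0
    simp only [add_zero] at h
    exact h.congr ((psiW_eventuallyEq hχ1 (by simp)).symm.iteratedDeriv n)
  · exact .of_contDiffAt hβ1 (contDiffAt_iteratedDeriv n (psiW_contDiffAt_of_ne hχ hx))

lemma memC0_psiW {n : ℕ} {β : ℝ} (hβ0 : 0 < β) (hβ1 : β ≤ 1) {χ : ℝ → ℝ}
    (hχ : ContDiff ℝ (⊤ : ℕ∞) χ) (hχc : HasCompactSupport χ)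
    (hχ1 : ∀ x ∈ Icc (-1 : ℝ) 1, χ x = 1) : MemC0 n β (psiW n β χ) :=
  memC0_of_holderNear hβ0 (psiW_contDiff hβ0 hχ) (hχc.mul_left)
    (holderNear_iteratedDeriv_psiW hβ0 hβ1 hχ hχ1)

lemma memC0_of_contDiff {n : ℕ} {β : ℝ} (hβ0 : 0 < β) (hβ1 : β ≤ 1) {f : ℝ → ℝ}
    (hf : ContDiff ℝ (⊤ : ℕ∞) f) (hc : HasCompactSupport f) : MemC0 n β f :=
  memC0_of_holderNear hβ0 (hf.of_le (by exact_mod_cast le_top)) hc fun _ =>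
    .of_contDiffAt hβ1 (contDiffAt_iteratedDeriv n hf.contDiffAt)

lemma tendsto_hnorm_div {n : ℕ} {β : ℝ} (hβ0 : 0 < β) (hβ1 : β ≤ 1) {f : ℝ → ℝ}
    (hf : ContDiff ℝ (⊤ : ℕ∞) f) (hc : HasCompactSupport f) :
    Tendsto (fun k : ℕ => hnorm n β (fun x => f x / (k : ℝ))) atTop (𝓝 0) := by
  obtain ⟨M, hM, hM'⟩ := exists_bounds (n := n) hβ0
    (hf.of_le (by exact_mod_cast le_top)) hc fun _ =>
    HolderNear.of_contDiffAt hβ1 (contDiffAt_iteratedDeriv n hf.contDiffAt)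
  refine squeeze_zero (fun k => ENNReal.toReal_nonneg) (fun k => ?_)
    (tendsto_const_div_atTop_nhds_zero_nat M)
  have hM0 : 0 ≤ M := (abs_nonneg _).trans (hM 0 (Nat.zero_le n) 0)
  have hD : ∀ l x, iteratedDeriv l (fun x => f x / (k : ℝ)) x =
      iteratedDeriv l f x / (k : ℝ) := fun l x => by
    simp only [div_eq_inv_mul, iteratedDeriv_const_mul_field]
  have hk : (0 : ℝ) ≤ k := Nat.cast_nonneg k
  refine ENNReal.toReal_le_of_le_ofReal (by positivity) (eHnorm_le_of_bounds ?_ ?_)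
  · intro l hl x
    rw [hD, abs_div, abs_of_nonneg hk]
    exact div_le_div_of_nonneg_right (hM l hl x) hk
  · intro x y
    rw [hD, hD, ← sub_div, abs_div, abs_of_nonneg hk, div_mul_eq_mul_div]
    exact div_le_div_of_nonneg_right (hM' x y) hk

lemma exists_memD1 {n : ℕ} {β : ℝ} (hβ0 : 0 < β) (hβ1 : β ≤ 1) {χ : ℝ → ℝ}
    (hχ : ContDiff ℝ (⊤ : ℕ∞) χ) (hχc : HasCompactSupport χ) :
    ∃ K : ℕ, ∀ k ≥ K, MemD1 n β (fun x => x + χ x / (k : ℝ)) := by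
  obtain ⟨B, hB⟩ := hχc.deriv.exists_bound_of_continuous (hχ.continuous_deriv (by simp))
  obtain ⟨K, hK⟩ := exists_nat_gt B
  have hB0 : 0 ≤ B := (norm_nonneg _).trans (hB 0)
  refine ⟨K, fun k hk => ⟨?_, fun x => ?_⟩⟩
  · simp only [add_sub_cancel_left]
    refine memC0_of_contDiff hβ0 hβ1 (hχ.div_const _) ?_
    simp only [div_eq_mul_inv]
    exact hχc.mul_right
  · have hkB : B < k := hK.trans_le (by exact_mod_cast hk)
    have hk0 : (0 : ℝ) < k := hB0.trans_lt hkB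
    have hd : HasDerivAt (fun x => x + χ x / (k : ℝ)) (1 + deriv χ x / k) x :=
      (hasDerivAt_id x).add
        (((hχ.differentiable (by simp)).differentiableAt.hasDerivAt).div_const _)
    rw [hd.deriv]
    have h1 := (abs_le.1 (hB x)).1
    have h2 : -1 < deriv χ x / k := by
      rw [lt_div_iff₀ hk0]
      linarith
    linarith

lemma memC0_psiW_comp_sub {n : ℕ} {β : ℝ} (hβ0 : 0 < β) (hβ1 : β ≤ 1) {χ : ℝ → ℝ}
    (hχ : ContDiff ℝ (⊤ : ℕ∞) χ) (hχc : HasCompactSupport χ)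
    (hχ1 : ∀ x ∈ Icc (-1 : ℝ) 1, χ x = 1) {c : ℝ} (hc : 1 < c)
    (hinj : Injective fun x => x + χ x / c) :
    MemC0 n β (fun x => psiW n β χ (x + χ x / c) - psiW n β χ x) := by
  have hΦ : ContDiff ℝ (⊤ : ℕ∞) (fun x => x + χ x / c) := contDiff_id.add (hχ.div_const c)
  have hψ : ContDiff ℝ n (psiW n β χ) := psiW_contDiff hβ0 hχ
  have hcomp : ContDiff ℝ n (fun x => psiW n β χ (x + χ x / c)) :=
    hψ.comp (hΦ.of_le (by exact_mod_cast le_top))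
  have hc0 : 0 < c := by linarith
  have hc1 : 1 / c < 1 := (div_lt_one hc0).2 hc
  have habs : |-(1 / c)| < 1 := by rwa [abs_neg, abs_of_pos (by positivity)]
  refine memC0_of_holderNear hβ0 (hcomp.sub hψ) ?_ fun x => ?_
  · refine hχc.mono fun x hx hχx => hx ?_
    simp [hχx]
  · have hsub : iteratedDeriv n (fun x => psiW n β χ (x + χ x / c) - psiW n β χ x) =
        fun y => iteratedDeriv n (fun x => psiW n β χ (x + χ x / c)) y -
          iteratedDeriv n (psiW n β χ) y :=
      funext fun y => iteratedDeriv_fun_sub hcomp.contDiffAt hψ.contDiffAt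
    rw [hsub]
    refine HolderNear.sub ?_ (holderNear_iteratedDeriv_psiW hβ0 hβ1 hχ hχ1 x)
    by_cases hx : x + χ x / c = 0
    · have hx' : x = -(1 / c) := hinj (by
        simp only [hx, hχ1 _ (abs_le.1 habs.le), neg_add_cancel])
      subst hx'
      exact (holderNear_iteratedDeriv_pow_mul_abs_rpow hβ0 hβ1 n (1 / c) _).congr
        ((psiW_comp_eventuallyEq hχ1 habs (by simp)).symm.iteratedDeriv n)
    · exact .of_contDiffAt hβ1 (contDiffAt_iteratedDeriv n
        (ContDiffAt.comp x (psiW_contDiffAt_of_ne hχ hx) hΦ.contDiffAt))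

lemma le_hnorm_psiW_comp_sub {n : ℕ} {β : ℝ} (hβ0 : 0 < β) (hβ1 : β ≤ 1) {χ : ℝ → ℝ}
    (hχ : ContDiff ℝ (⊤ : ℕ∞) χ) (hχc : HasCompactSupport χ)
    (hχ1 : ∀ x ∈ Icc (-1 : ℝ) 1, χ x = 1) {c : ℝ} (hc : 1 < c)
    (hinj : Injective fun x => x + χ x / c) :
    2 * ∏ j ∈ Finset.range n, ((j : ℝ) + 1 + β) ≤
      hnorm n β (fun x => psiW n β χ (x + χ x / c) - psiW n β χ x) := by
  have hc0 : 0 < c := by linarith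
  have hc1 : 1 / c < 1 := (div_lt_one hc0).2 hc
  have hpos : 0 < 1 / c := by positivity
  have habs : |-(1 / c)| < 1 := by rwa [abs_neg, abs_of_pos hpos]
  have habs' : |0 + 1 / c| < 1 := by rwa [zero_add, abs_of_pos hpos]
  have hu := contDiff_pow_mul_abs_rpow hβ0 n
  have hD : ∀ x : ℝ, |x| < 1 → |x + 1 / c| < 1 →
      iteratedDeriv n (fun x => psiW n β χ (x + χ x / c) - psiW n β χ x) x =
        (∏ j ∈ Finset.range n, ((j : ℝ) + 1 + β)) * |x + 1 / c| ^ β -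
          (∏ j ∈ Finset.range n, ((j : ℝ) + 1 + β)) * |x| ^ β := by
    intro x hx hx'
    have hu' : ContDiff ℝ n fun y : ℝ => (y + 1 / c) ^ n * |y + 1 / c| ^ β :=
      hu.comp (contDiff_id.add contDiff_const)
    refine (((psiW_comp_eventuallyEq hχ1 hx hx').sub
      (psiW_eventuallyEq hχ1 hx)).iteratedDeriv_eq n).trans ?_
    rw [iteratedDeriv_sub hu'.contDiffAt hu.contDiffAt,
      iteratedDeriv_comp_add_const n (fun y : ℝ => y ^ n * |y| ^ β)]
    simp only [iteratedDeriv_pow_mul_abs_rpow hβ0]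
  have h := div_le_hnorm (memC0_psiW_comp_sub (n := n) hβ0 hβ1 hχ hχc hχ1 hc hinj).1.2
    (x := 0) (y := -(1 / c)) (by simpa using hc0.ne')
  refine le_trans (le_of_eq ?_) h
  have hP : 0 ≤ ∏ j ∈ Finset.range n, ((j : ℝ) + 1 + β) :=
    Finset.prod_nonneg fun j _ => by positivity
  have hq : 0 < (1 / c) ^ β := by positivity
  rw [hD 0 (by simp) habs', hD _ habs (by simp)]
  simp only [zero_add, neg_add_cancel, abs_zero, Real.zero_rpow hβ0.ne', mul_zero, sub_zero,
    zero_sub, abs_neg, sub_neg_eq_add, abs_of_pos hpos]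
  rw [abs_of_nonneg (by positivity), eq_div_iff hq.ne']
  ring

/-- discontinuity of left translations in `D^{n,β}(ℝ)`:
with `χ ∈ C_c^∞(ℝ)`, `χ ≡ 1` on `[−1,1]`, `ψ(x) = xⁿ|x|^β χ(x)` and
`Φ_k = Id + χ/k`, one has `ψ ∈ C^{n,β}_0(ℝ,ℝ)`, `Φ_k → Id` in `‖·‖_{n,β}`,
`Φ_k ∈ D^{n,β}(ℝ)` for large `k`, yet
`‖ψ∘Φ_k − ψ‖_{n,β} ≥ 2(1+β)⋯(n+β)` for large `k`; consequently the left
translation `f ↦ ψ∘f` on `D^{n,β}(ℝ)` is discontinuous at `Id`. -/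
theorem stmt10 (n : ℕ) (hn : 1 ≤ n) (β : ℝ) (hβ0 : 0 < β) (hβ1 : β ≤ 1)
    (χ : ℝ → ℝ) (hχsm : ContDiff ℝ (⊤ : ℕ∞) χ) (hχc : HasCompactSupport χ)
    (hχ1 : ∀ x ∈ Icc (-1 : ℝ) 1, χ x = 1) :
    MemC0 n β (psiW n β χ) ∧
    Tendsto (fun k : ℕ => hnorm n β (fun x => χ x / (k : ℝ))) atTop (𝓝 0) ∧
    (∃ K : ℕ, ∀ k ≥ K, MemD1 n β (fun x => x + χ x / (k : ℝ))) ∧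
    (∃ K : ℕ, ∀ k ≥ K,
      2 * ∏ j ∈ Finset.range n, ((j : ℝ) + 1 + β) ≤
        hnorm n β (fun x => psiW n β χ (x + χ x / (k : ℝ)) - psiW n β χ x)) ∧
    ¬ (∀ ε > (0 : ℝ), ∃ δ > (0 : ℝ), ∀ Φ : ℝ → ℝ, MemD1 n β Φ →
        hnorm n β (fun x => Φ x - x) < δ →
        hnorm n β (fun x => psiW n β χ (Φ x) - psiW n β χ x) < ε) := by
  have htendsto := tendsto_hnorm_div (n := n) hβ0 hβ1 hχsm hχc
  obtain ⟨K, hK⟩ := exists_memD1 (n := n) hβ0 hβ1 hχsm hχc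
  have hlower : ∀ k ≥ max K 2, 2 * ∏ j ∈ Finset.range n, ((j : ℝ) + 1 + β) ≤
      hnorm n β (fun x => psiW n β χ (x + χ x / (k : ℝ)) - psiW n β χ x) := fun k hk =>
    le_hnorm_psiW_comp_sub hβ0 hβ1 hχsm hχc hχ1
      (by exact_mod_cast (le_max_right K 2).trans hk)
      (strictMono_of_deriv_pos (hK k ((le_max_left K 2).trans hk)).2).injective
  refine ⟨memC0_psiW hβ0 hβ1 hχsm hχc hχ1, htendsto, ⟨K, hK⟩, ⟨_, hlower⟩, fun hcont => ?_⟩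
  obtain ⟨δ, hδ, hcont⟩ := hcont (2 * ∏ j ∈ Finset.range n, ((j : ℝ) + 1 + β))
    (mul_pos two_pos (Finset.prod_pos fun j _ => by positivity))
  obtain ⟨k, hkδ, hk⟩ :=
    ((htendsto.eventually_lt_const hδ).and (eventually_ge_atTop (max K 2))).exists
  refine (hcont _ (hK k ((le_max_left K 2).trans hk)) ?_).not_ge (hlower k hk)
  simpa only [add_sub_cancel_left] using hkδ
end
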